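/- arXiv:2603.08186 — 4 statements merged into one kernel-verified Lean document; each statement's English description precedes it below -/
import Mathlib

section
/- Let (X, d, μ) be a metric measure space whose measure is Ahlfors ν-regular with constants 0 < c₁ ≤ c₂ < ∞ satisfying 2^{1−ν}·(c₂/c₁) < 1, and let K be a kernel satisfying the size condition and the pseudo-radial null condition. Let f : X → ℝ be locally integrable and let g : X → [0,∞] be locally integrable such that the pair (f, g) satisfies a weak (1, ρ')-Poincaré–Sobolev inequality for some 1 < ρ' < ν. If moreover g belongs to the Morrey space M^{p,q}_μ(X) for some 1 < p ≤ q < ∞ with q/ν < 1, then there is a constant C such that for every x ∈ X, T*_K f(x) ≤ C · M_μ(g)(x)^{1 − q/ν} · ‖g‖_{M^{p,q}}^{q/ν}. -/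
open MeasureTheory Metric ENNReal

variable {X : Type*} [MetricSpace X] [MeasurableSpace X] [BorelSpace X]

/-- Riesz-type potential `R_{s,μ} g (x) = ∫ d(x,y)^s / μ(B(x,d(x,y))) · g(y) dμ(y)`,
for `g : X → [0,∞]`, valued in `[0,∞]`. -/
noncomputable def rieszPot (μ : Measure X) (s : ℝ) (g : X → ℝ≥0∞) (x : X) : ℝ≥0∞ :=
  ∫⁻ y, (ENNReal.ofReal (dist x y ^ s) / μ (ball x (dist x y))) * g y ∂μ

/-- Riesz-type potential applied to a real (signed) function, as a Bochner integral. -/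
noncomputable def rieszR (μ : Measure X) (s : ℝ) (f : X → ℝ) (x : X) : ℝ :=
  ∫ y, (dist x y ^ s / (μ (ball x (dist x y))).toReal) * f y ∂μ

/-- Hardy–Littlewood maximal function: sup over open balls containing `x`. -/
noncomputable def maximalFn (μ : Measure X) (g : X → ℝ≥0∞) (x : X) : ℝ≥0∞ :=
  ⨆ (z : X) (r : ℝ) (_ : 0 < r) (_ : x ∈ ball z r),
    (μ (ball z r))⁻¹ * ∫⁻ y in ball z r, g y ∂μ

/-- Morrey norm `‖g‖_{M^{p,q}}`, valued in `[0,∞]`. -/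
noncomputable def morreyNorm (μ : Measure X) (p q : ℝ) (g : X → ℝ≥0∞) : ℝ≥0∞ :=
  ⨆ (z : X) (r : ℝ) (_ : 0 < r),
    (μ (ball z r) ^ (p / q - 1) * ∫⁻ y in ball z r, g y ^ p ∂μ) ^ (1 / p)

/-- Truncated singular integral `T^ε_K f (x)`. -/
noncomputable def truncT (μ : Measure X) (K : X → X → ℝ) (f : X → ℝ) (ε : ℝ) (x : X) : ℝ :=
  ∫ y in {y | ε < dist x y}, K x y * f y ∂μ

/-- Maximal singular operator `T^*_K f (x) = sup_{ε>0} |T^ε_K f (x)|`, valued in `[0,∞]`. -/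
noncomputable def maxT (μ : Measure X) (K : X → X → ℝ) (f : X → ℝ) (x : X) : ℝ≥0∞ :=
  ⨆ (ε : ℝ) (_ : 0 < ε), ENNReal.ofReal |truncT μ K f ε x|

/-- Ahlfors `ν`-regularity: `c₁ r^ν ≤ μ(B(x,r)) ≤ c₂ r^ν`. -/
def IsAhlfors (μ : Measure X) (c₁ c₂ ν : ℝ) : Prop :=
  ∀ (x : X) (r : ℝ), 0 < r →
    ENNReal.ofReal (c₁ * r ^ ν) ≤ μ (ball x r) ∧ μ (ball x r) ≤ ENNReal.ofReal (c₂ * r ^ ν)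

/-- Size condition on the kernel: `|K(x,y)| ≤ C_K / d(x,y)^ν` for `x ≠ y`. -/
def SizeCond (K : X → X → ℝ) (CK ν : ℝ) : Prop :=
  ∀ x y : X, x ≠ y → |K x y| ≤ CK / dist x y ^ ν

/-- Pseudo-radial null condition: `∫_{a < d(x,y) < b} K(x,y) dμ(y) = 0`. -/
def NullCond (μ : Measure X) (K : X → X → ℝ) : Prop :=
  ∀ (x : X) (a b : ℝ), 0 < a → a < b →
    ∫ y in {y | a < dist x y ∧ dist x y < b}, K x y ∂μ = 0

/-- Weak `(1,ρ')`-Poincaré–Sobolev inequality for the pair `(f,g)` with constants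
`C_P > 0` and dilation `σ`. -/
def PoincareSobolev (μ : Measure X) (f : X → ℝ) (g : X → ℝ≥0∞) (ρ' CP σ : ℝ) : Prop :=
  ∀ (x : X) (r : ℝ), 0 < r →
    ((μ (ball x r))⁻¹ *
        ∫⁻ y in ball x r, ENNReal.ofReal (|f y - ⨍ z in ball x r, f z ∂μ| ^ ρ') ∂μ) ^ (1 / ρ')
      ≤ ENNReal.ofReal (CP * r) *
        ((μ (ball x (σ * r)))⁻¹ * ∫⁻ y in ball x (σ * r), g y ∂μ)

/-- Local integrability for an `[0,∞]`-valued function: measurable with finite integral on balls. -/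
def LocIntE (μ : Measure X) (g : X → ℝ≥0∞) : Prop :=
  Measurable g ∧ ∀ (z : X) (r : ℝ), ∫⁻ y in ball z r, g y ∂μ < ∞

/-- `L^r` norm (in `[0,∞]`) of an `[0,∞]`-valued function. -/
noncomputable def lpNormE (μ : Measure X) (r : ℝ) (h : X → ℝ≥0∞) : ℝ≥0∞ :=
  (∫⁻ x, h x ^ r ∂μ) ^ (1 / r)

/-- Lorentz `L^{r,m}` quasinorm (in `[0,∞]`) of an `[0,∞]`-valued function. -/
noncomputable def lorentzNormE (μ : Measure X) (r m : ℝ) (h : X → ℝ≥0∞) : ℝ≥0∞ :=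
  ENNReal.ofReal (r ^ (1 / m)) *
    (∫⁻ α in Set.Ioi (0 : ℝ),
        (ENNReal.ofReal α * μ {x | ENNReal.ofReal α < h x} ^ (1 / r)) ^ m *
          ENNReal.ofReal α⁻¹) ^ (1 / m)

theorem inv_measure_mul_setLIntegral_le_rpow {X : Type*} [MeasurableSpace X] {μ : Measure X}
    {s : Set X} (h0 : μ s ≠ 0) (htop : μ s ≠ ∞) {p : ℝ} (hp : 1 < p) (h : X → ℝ≥0∞) :
    (μ s)⁻¹ * ∫⁻ y in s, h y ∂μ ≤ ((μ s)⁻¹ * ∫⁻ y in s, h y ^ p ∂μ) ^ (1 / p) := by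
  obtain ⟨h', hm, hle, heq⟩ := exists_measurable_le_lintegral_eq (μ.restrict s) h
  have : IsProbabilityMeasure ((μ s)⁻¹ • μ.restrict s) :=
    ⟨by simp [ENNReal.inv_mul_cancel h0 htop]⟩
  have key := eLpNorm'_le_eLpNorm'_of_exponent_le one_pos hp.le ((μ s)⁻¹ • μ.restrict s)
    (f := h') hm.aestronglyMeasurable
  simp only [eLpNorm'_eq_lintegral_enorm, lintegral_smul_measure, enorm_eq_self, rpow_one, div_one,
    smul_eq_mul] at key
  rw [heq]
  refine key.trans ?_
  gcongr
  exact hle _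

theorem sum_min_two_pow_mul_le {s t : ℝ} (hs : 0 < s) (ht : 0 < t) (n : ℕ) :
    ∑ k ∈ Finset.range n, min (2 ^ k * t) ((2 ^ k * t) ^ (-s)) ≤ 2 + (1 - 2 ^ (-s))⁻¹ := by
  have h2 : (2 : ℝ) ^ (-s) < 1 := Real.rpow_lt_one_of_one_lt_of_neg one_lt_two (by linarith)
  have hB : 0 < (1 - (2 : ℝ) ^ (-s))⁻¹ := inv_pos.2 (by linarith)
  set B := (1 - (2 : ℝ) ^ (-s))⁻¹ with hBdef
  have hB1 : B * (1 - (2 : ℝ) ^ (-s)) = 1 := inv_mul_cancel₀ (by linarith)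
  let Φ : ℝ → ℝ := fun u => min u 2 - B * min 1 (u ^ (-s))
  have step : ∀ u : ℝ, 0 < u → min u (u ^ (-s)) ≤ Φ (2 * u) - Φ u := by
    intro u hu
    have hmul : (2 * u) ^ (-s) = 2 ^ (-s) * u ^ (-s) := Real.mul_rpow two_pos.le hu.le
    have hus : 0 < u ^ (-s) := Real.rpow_pos_of_pos hu _
    have hanti : (2 * u) ^ (-s) ≤ u ^ (-s) := by rw [hmul]; nlinarith
    simp only [Φ]
    rcases le_total u 1 with h1 | h1
    · have : B * min 1 ((2 * u) ^ (-s)) ≤ B * min 1 (u ^ (-s)) := by gcongr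
      rw [min_eq_left (show u ≤ 2 by linarith), min_eq_left (show 2 * u ≤ 2 by linarith)]
      linarith [min_le_left u (u ^ (-s))]
    · have hu1 : u ^ (-s) ≤ 1 := Real.rpow_le_one_of_one_le_of_nonpos h1 (by linarith)
      have : min u 2 ≤ min (2 * u) 2 := by gcongr; linarith
      rw [min_eq_right hu1, min_eq_right (hanti.trans hu1), hmul]
      have : B * u ^ (-s) - B * (2 ^ (-s) * u ^ (-s)) = u ^ (-s) := by linear_combination u ^ (-s) * hB1
      linarith [min_le_right u (u ^ (-s))]
  calc _ ≤ ∑ k ∈ Finset.range n, (Φ (2 ^ (k + 1) * t) - Φ (2 ^ k * t)) := by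
        refine Finset.sum_le_sum fun k _ => ?_
        rw [pow_succ', mul_assoc]
        exact step _ (by positivity)
    _ = Φ (2 ^ n * t) - Φ (2 ^ 0 * t) := Finset.sum_range_sub (fun k => Φ (2 ^ k * t)) n
    _ ≤ 2 + B := by
        have h1 : 0 ≤ B * min 1 ((2 ^ n * t) ^ (-s)) := by positivity
        have h2 : B * min 1 ((2 ^ 0 * t) ^ (-s)) ≤ B * 1 := by gcongr; exact min_le_left _ _
        have h3 : 0 ≤ min (2 ^ 0 * t) 2 := by positivity
        simp only [Φ]
        linarith [min_le_right (2 ^ n * t) 2]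

theorem sum_two_pow_mul_le_interpolation {a m b r : ℝ} (ha : 1 < a) (hm : 0 ≤ m) (hb : 0 ≤ b)
    (hr : 0 < r) {v : ℕ → ℝ} (hvm : ∀ k, v k ≤ m) (hvb : ∀ k, v k ≤ b * (2 ^ k * r) ^ (-a))
    (n : ℕ) :
    ∑ k ∈ Finset.range n, 2 ^ k * r * v k ≤
      (2 + (1 - 2 ^ (-(a - 1)))⁻¹) * (m ^ (1 - 1 / a) * b ^ (1 / a)) := by
  have ha0 : 0 < a := by linarith
  have hinv : 1 / a < 1 := by rw [div_lt_one ha0]; exact ha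
  by_cases h0 : m = 0 ∨ b = 0
  · have hz : m ^ (1 - 1 / a) * b ^ (1 / a) = 0 := by
      rcases h0 with rfl | rfl
      · rw [Real.zero_rpow (by linarith), zero_mul]
      · rw [Real.zero_rpow (by positivity), mul_zero]
    rw [hz, mul_zero]
    refine Finset.sum_nonpos fun k _ => mul_nonpos_of_nonneg_of_nonpos (by positivity) ?_
    rcases h0 with rfl | rfl
    · exact hvm k
    · simpa using hvb k
  push Not at h0
  have hm' : 0 < m := hm.lt_of_ne' h0.1
  have hb' : 0 < b := hb.lt_of_ne' h0.2
  set R := (b / m) ^ (1 / a) with hR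
  have hR0 : 0 < R := by positivity
  have hRa : m * R ^ a = b := by
    rw [hR, ← Real.rpow_mul (by positivity), one_div_mul_cancel ha0.ne', Real.rpow_one]
    field_simp
  have hmR : m * R = m ^ (1 - 1 / a) * b ^ (1 / a) := by
    rw [hR, Real.div_rpow hb hm, Real.rpow_sub hm', Real.rpow_one]
    ring
  calc _ ≤ ∑ k ∈ Finset.range n,
        m * R * min (2 ^ k * (r / R)) ((2 ^ k * (r / R)) ^ (-(a - 1))) := by
        refine Finset.sum_le_sum fun k _ => ?_
        rw [mul_min_of_nonneg _ _ (by positivity)]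
        refine le_min ?_ ?_
        · calc _ ≤ 2 ^ k * r * m := by gcongr; exact hvm k
            _ = _ := by field_simp
        · calc _ ≤ 2 ^ k * r * (b * (2 ^ k * r) ^ (-a)) := by gcongr; exact hvb k
            _ = _ := by
              have hu : 2 ^ k * r = (2 ^ k * (r / R)) * R := by field_simp
              have hu0 : 0 < 2 ^ k * (r / R) := by positivity
              rw [hu]
              set u := 2 ^ k * (r / R)
              rw [Real.mul_rpow hu0.le hR0.le, ← hRa, Real.rpow_neg hR0.le, neg_sub,
                Real.rpow_sub hu0, Real.rpow_neg hu0.le, Real.rpow_one]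
              have := Real.rpow_pos_of_pos hR0 a
              field_simp
    _ ≤ _ := by
        rw [← Finset.mul_sum, hmR, mul_comm]
        gcongr
        exact sum_min_two_pow_mul_le (by linarith) (by positivity) n

set_option linter.unusedSectionVars false

section Annuli

variable {μ : Measure X} {c₁ c₂ ν CK : ℝ} {K : X → X → ℝ}

theorem IsAhlfors.measure_ball_lt_top (hA : IsAhlfors μ c₁ c₂ ν) (x : X) {r : ℝ} (hr : 0 < r) :
    μ (ball x r) < ∞ :=
  (hA x r hr).2.trans_lt ofReal_lt_top

theorem IsAhlfors.measure_ball_ne_zero (hA : IsAhlfors μ c₁ c₂ ν) (hc₁ : 0 < c₁) (x : X) {r : ℝ}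
    (hr : 0 < r) : μ (ball x r) ≠ 0 :=
  ((ofReal_pos.2 (by positivity)).trans_le (hA x r hr).1).ne'

theorem SizeCond.enorm_le (hsize : SizeCond K CK ν) (hCK : 0 ≤ CK) (hν : 0 ≤ ν) {x y : X} {a : ℝ}
    (ha : 0 < a) (hy : a < dist x y) : ‖K x y‖ₑ ≤ ENNReal.ofReal (CK / a ^ ν) := by
  rw [← ofReal_norm]
  refine ofReal_le_ofReal ((hsize x y (dist_pos.1 (ha.trans hy))).trans ?_)
  gcongr

theorem measurableSet_lt_dist (x : X) (a : ℝ) : MeasurableSet {y | a < dist x y} :=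
  (isOpen_lt continuous_const (continuous_const.dist continuous_id)).measurableSet

theorem measurableSet_annulus (x : X) (a b : ℝ) :
    MeasurableSet {y | a < dist x y ∧ dist x y ≤ b} :=
  (measurableSet_lt_dist x a).inter
    (isClosed_le (continuous_const.dist continuous_id) continuous_const).measurableSet

theorem SizeCond.integrableOn (hsize : SizeCond K CK ν) (hCK : 0 ≤ CK) (hν : 0 ≤ ν)
    (hA : IsAhlfors μ c₁ c₂ ν) (hK : Measurable (Function.uncurry K)) (x : X) {a : ℝ} (b : ℝ)
    (ha : 0 < a) (hb : 0 < b) :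
    IntegrableOn (K x) {y | a < dist x y ∧ dist x y < b} μ := by
  have hm : MeasurableSet {y | a < dist x y ∧ dist x y < b} :=
    (measurableSet_lt_dist x a).inter
      (isOpen_lt (continuous_const.dist continuous_id) continuous_const).measurableSet
  refine Measure.integrableOn_of_bounded (M := CK / a ^ ν) ?_
    hK.of_uncurry_left.aestronglyMeasurable ?_
  · refine ((measure_mono fun y hy => ?_).trans_lt (hA.measure_ball_lt_top x hb)).ne
    exact mem_ball'.2 hy.2
  · filter_upwards [ae_restrict_mem hm] with y hy
    have := hsize.enorm_le hCK hν ha hy.1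
    rwa [← ofReal_norm, ofReal_le_ofReal_iff (by positivity)] at this

theorem NullCond.setIntegral_annulus_eq_zero (hnull : NullCond μ K) (hsize : SizeCond K CK ν)
    (hCK : 0 ≤ CK) (hν : 0 ≤ ν) (hA : IsAhlfors μ c₁ c₂ ν) (hK : Measurable (Function.uncurry K))
    (x : X) {a b : ℝ} (ha : 0 < a) (hab : a < b) :
    ∫ y in {y | a < dist x y ∧ dist x y ≤ b}, K x y ∂μ = 0 := by
  have hb : 0 < b := ha.trans hab
  have hi := hsize.integrableOn hCK hν hA hK x (b + 1) ha (by linarith)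
  have hunion : {y | a < dist x y ∧ dist x y < b + 1} =
      {y | a < dist x y ∧ dist x y ≤ b} ∪ {y | b < dist x y ∧ dist x y < b + 1} := by
    ext y
    simp only [Set.mem_ofPred_eq, Set.mem_union]
    grind
  have hdisj : Disjoint {y | b < dist x y ∧ dist x y < b + 1}
      {y | a < dist x y ∧ dist x y ≤ b} :=
    Set.disjoint_left.2 fun y h1 h2 => h1.1.not_ge h2.2
  have h1 := hnull x a (b + 1) ha (by linarith)
  rw [hunion, Set.union_comm, setIntegral_union hdisj (measurableSet_annulus x a b)
    (hi.mono_set (hunion ▸ Set.subset_union_right))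
    (hi.mono_set (hunion ▸ Set.subset_union_left)), hnull x b (b + 1) hb (by linarith),
    zero_add] at h1
  exact h1

theorem NullCond.enorm_setIntegral_annulus_le (hnull : NullCond μ K) (hsize : SizeCond K CK ν)
    (hCK : 0 ≤ CK) (hν : 0 ≤ ν) (hA : IsAhlfors μ c₁ c₂ ν) (hK : Measurable (Function.uncurry K))
    (f : X → ℝ) (c : ℝ) (x : X) {a b d : ℝ} (ha : 0 < a) (hab : a < b) (hbd : b < d)
    (hf : IntegrableOn (fun y => K x y * f y) {y | a < dist x y ∧ dist x y ≤ b} μ) :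
    ‖∫ y in {y | a < dist x y ∧ dist x y ≤ b}, K x y * f y ∂μ‖ₑ ≤
      ENNReal.ofReal (CK / a ^ ν) * ∫⁻ y in ball x d, ‖f y - c‖ₑ ∂μ := by
  have hi : IntegrableOn (K x) {y | a < dist x y ∧ dist x y ≤ b} μ :=
    (hsize.integrableOn hCK hν hA hK x d ha (ha.trans (hab.trans hbd))).mono_set
      fun y hy => ⟨hy.1, hy.2.trans_lt hbd⟩
  have heq : ∫ y in {y | a < dist x y ∧ dist x y ≤ b}, K x y * f y ∂μ =
      ∫ y in {y | a < dist x y ∧ dist x y ≤ b}, K x y * (f y - c) ∂μ := by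
    simp_rw [mul_sub]
    rw [integral_sub hf (hi.mul_const c), integral_mul_const,
      hnull.setIntegral_annulus_eq_zero hsize hCK hν hA hK x ha hab, zero_mul, sub_zero]
  rw [heq]
  calc _ ≤ ∫⁻ y in {y | a < dist x y ∧ dist x y ≤ b}, ‖K x y * (f y - c)‖ₑ ∂μ :=
        enorm_integral_le_lintegral_enorm _
    _ ≤ ∫⁻ y in {y | a < dist x y ∧ dist x y ≤ b},
          ENNReal.ofReal (CK / a ^ ν) * ‖f y - c‖ₑ ∂μ := by
        refine setLIntegral_mono' (measurableSet_annulus x a b) fun y hy => ?_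
        rw [enorm_mul]
        gcongr
        exact hsize.enorm_le hCK hν ha hy.1
    _ = ENNReal.ofReal (CK / a ^ ν) *
          ∫⁻ y in {y | a < dist x y ∧ dist x y ≤ b}, ‖f y - c‖ₑ ∂μ :=
        lintegral_const_mul' _ _ ofReal_ne_top
    _ ≤ _ := by
        gcongr
        exact fun y hy => mem_ball'.2 (hy.2.trans_lt hbd)

theorem PoincareSobolev.setLIntegral_le {f : X → ℝ} {g : X → ℝ≥0∞} {ρ' CP σ : ℝ}
    (hPS : PoincareSobolev μ f g ρ' CP σ) (hρ' : 1 < ρ') (hA : IsAhlfors μ c₁ c₂ ν) (hc₁ : 0 < c₁)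
    (x : X) {r : ℝ} (hr : 0 < r) :
    ∫⁻ y in ball x r, ‖f y - ⨍ z in ball x r, f z ∂μ‖ₑ ∂μ ≤
      ENNReal.ofReal (c₂ * r ^ ν) * (ENNReal.ofReal (CP * r) *
        ((μ (ball x (σ * r)))⁻¹ * ∫⁻ y in ball x (σ * r), g y ∂μ)) := by
  have h0 := hA.measure_ball_ne_zero hc₁ x hr
  have htop := (hA.measure_ball_lt_top x hr).ne
  have hpow (t : ℝ) : ENNReal.ofReal (|t| ^ ρ') = ‖t‖ₑ ^ ρ' := by
    rw [← ofReal_rpow_of_nonneg (abs_nonneg _) (by linarith), ← Real.norm_eq_abs, ofReal_norm]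
  have h := hPS x r hr
  simp_rw [hpow] at h
  calc _ = μ (ball x r) * ((μ (ball x r))⁻¹ *
          ∫⁻ y in ball x r, ‖f y - ⨍ z in ball x r, f z ∂μ‖ₑ ∂μ) := by
        rw [← mul_assoc, ENNReal.mul_inv_cancel h0 htop, one_mul]
    _ ≤ _ := by
        exact mul_le_mul' (hA x r hr).2
          ((inv_measure_mul_setLIntegral_le_rpow h0 htop hρ' _).trans h)

theorem le_maximalFn (μ : Measure X) (g : X → ℝ≥0∞) (x : X) {r : ℝ} (hr : 0 < r) :
    (μ (ball x r))⁻¹ * ∫⁻ y in ball x r, g y ∂μ ≤ maximalFn μ g x :=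
  le_iSup_of_le x <| le_iSup_of_le r <| le_iSup_of_le hr <|
    le_iSup_of_le (mem_ball_self hr) le_rfl

theorem IsAhlfors.average_le_morreyNorm (hA : IsAhlfors μ c₁ c₂ ν) (hc₁ : 0 < c₁) {p q : ℝ}
    (hp : 1 < p) (hq : 0 < q) (g : X → ℝ≥0∞) (x : X) {r : ℝ} (hr : 0 < r) :
    (μ (ball x r))⁻¹ * ∫⁻ y in ball x r, g y ∂μ ≤
      ENNReal.ofReal ((c₁ * r ^ ν) ^ (-(1 / q))) * morreyNorm μ p q g := by
  have h0 := hA.measure_ball_ne_zero hc₁ x hr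
  have htop := (hA.measure_ball_lt_top x hr).ne
  have hp0 : 0 < p := by linarith
  calc _ ≤ ((μ (ball x r))⁻¹ * ∫⁻ y in ball x r, g y ^ p ∂μ) ^ (1 / p) :=
        inv_measure_mul_setLIntegral_le_rpow h0 htop hp g
    _ = (μ (ball x r) ^ (-(p / q)) *
          (μ (ball x r) ^ (p / q - 1) * ∫⁻ y in ball x r, g y ^ p ∂μ)) ^ (1 / p) := by
        rw [← mul_assoc, ← ENNReal.rpow_add _ _ h0 htop, ← rpow_neg_one]
        congr 3
        ring
    _ = μ (ball x r) ^ (-(1 / q)) *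
          (μ (ball x r) ^ (p / q - 1) * ∫⁻ y in ball x r, g y ^ p ∂μ) ^ (1 / p) := by
        rw [ENNReal.mul_rpow_of_nonneg _ _ (by positivity), ← ENNReal.rpow_mul]
        congr 2
        field_simp
    _ ≤ _ := by
        gcongr
        · rw [← ofReal_rpow_of_pos (by positivity), ENNReal.rpow_neg, ENNReal.rpow_neg,
            ENNReal.inv_le_inv]
          exact ENNReal.rpow_le_rpow (hA x r hr).1 (by positivity)
        · exact le_iSup_of_le x <| le_iSup_of_le r <| le_iSup_of_le hr le_rfl

end Annuli

theorem iUnion_dyadic_annulus (x : X) {ε : ℝ} (hε : 0 < ε) :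
    ⋃ k : ℕ, {y | 2 ^ k * ε < dist x y ∧ dist x y ≤ 2 ^ (k + 1) * ε} = {y | ε < dist x y} := by
  ext y
  simp only [Set.mem_iUnion, Set.mem_ofPred_eq]
  constructor
  · rintro ⟨k, hk, -⟩
    have : (1 : ℝ) ≤ 2 ^ k := one_le_pow₀ one_le_two
    nlinarith
  · intro hy
    have h1y : 1 < dist x y / ε := (one_lt_div hε).2 hy
    obtain ⟨n, h1, h2⟩ := exists_mem_Ioc_zpow (one_pos.trans h1y) one_lt_two
    have hn : 0 < n + 1 := (one_lt_zpow_iff_right₀ _root_.one_lt_two).1 (h1y.trans_le h2)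
    lift n to ℕ using by omega with k
    rw [zpow_natCast] at h1
    rw [← Nat.cast_succ, zpow_natCast] at h2
    exact ⟨k, (lt_div_iff₀ hε).1 h1, (div_le_iff₀ hε).1 h2⟩

theorem pairwise_disjoint_dyadic_annulus (x : X) {ε : ℝ} (hε : 0 < ε) :
    Pairwise (Function.onFun Disjoint
      fun k : ℕ => {y | 2 ^ k * ε < dist x y ∧ dist x y ≤ 2 ^ (k + 1) * ε}) := by
  rw [pairwise_disjoint_on]
  intro m n hmn
  refine Set.disjoint_left.2 fun y h1 h2 => (h1.2.trans ?_).not_gt h2.1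
  gcongr
  · norm_num
  · omega

/-- If `f` satisfies a Poincaré–Sobolev inequality with right-hand side `g`, the truncations of
`K f` are controlled by bounds on the averages of `g` over dyadic balls. -/
theorem abs_truncT_le {μ : Measure X} {c₁ c₂ ν CK CP σ ρ' : ℝ} {K : X → X → ℝ} {f : X → ℝ}
    {g : X → ℝ≥0∞} (hc₁ : 0 < c₁) (hc₂ : 0 ≤ c₂) (hν : 0 ≤ ν) (hA : IsAhlfors μ c₁ c₂ ν)
    (hK : Measurable (Function.uncurry K)) (hCK : 0 ≤ CK) (hsize : SizeCond K CK ν)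
    (hnull : NullCond μ K) (hρ' : 1 < ρ') (hCP : 0 ≤ CP) (hPS : PoincareSobolev μ f g ρ' CP σ)
    (x : X) {ε : ℝ} (hε : 0 < ε) {v : ℕ → ℝ} {S : ℝ} (hv0 : ∀ k, 0 ≤ v k)
    (hv : ∀ k : ℕ, (μ (ball x (σ * (2 ^ k * (4 * ε)))))⁻¹ *
      ∫⁻ y in ball x (σ * (2 ^ k * (4 * ε))), g y ∂μ ≤ ENNReal.ofReal (v k))
    (hS : ∀ n, ∑ k ∈ Finset.range n, 2 ^ k * (4 * ε) * v k ≤ S) :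
    |truncT μ K f ε x| ≤ CK * c₂ * 4 ^ ν * CP * S := by
  have hS0 : 0 ≤ S := by simpa using hS 0
  by_cases hi : IntegrableOn (fun y => K x y * f y) {y | ε < dist x y} μ
  swap
  · rw [truncT, integral_undef hi, abs_zero]
    positivity
  rw [← iUnion_dyadic_annulus x hε] at hi
  have hsum := hasSum_integral_iUnion (fun k => measurableSet_annulus x _ _)
    (pairwise_disjoint_dyadic_annulus x hε) hi
  rw [iUnion_dyadic_annulus x hε] at hsum
  have hterm (k : ℕ) :
      ‖∫ y in {y | 2 ^ k * ε < dist x y ∧ dist x y ≤ 2 ^ (k + 1) * ε}, K x y * f y ∂μ‖ ≤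
        CK * c₂ * 4 ^ ν * CP * (2 ^ k * (4 * ε) * v k) := by
    have hr : 0 < 2 ^ k * (4 * ε) := by positivity
    have hvk := hv0 k
    rw [← ofReal_le_ofReal_iff (by positivity), ofReal_norm]
    calc _ ≤ ENNReal.ofReal (CK / (2 ^ k * ε) ^ ν) * ∫⁻ y in ball x (2 ^ k * (4 * ε)),
            ‖f y - ⨍ z in ball x (2 ^ k * (4 * ε)), f z ∂μ‖ₑ ∂μ := by
          refine hnull.enorm_setIntegral_annulus_le hsize hCK hν hA hK f _ x (by positivity) ?_ ?_
            (hi.mono_set (Set.subset_iUnion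
              (fun k : ℕ => {y | 2 ^ k * ε < dist x y ∧ dist x y ≤ 2 ^ (k + 1) * ε}) k))
          · gcongr <;> norm_num
          · have : 0 < 2 ^ k * ε := by positivity
            rw [pow_succ]
            linarith
      _ ≤ ENNReal.ofReal (CK / (2 ^ k * ε) ^ ν) *
            (ENNReal.ofReal (c₂ * (2 ^ k * (4 * ε)) ^ ν) *
              (ENNReal.ofReal (CP * (2 ^ k * (4 * ε))) * ENNReal.ofReal (v k))) := by
          gcongr
          refine (hPS.setLIntegral_le hρ' hA hc₁ x hr).trans ?_
          gcongr
          exact hv k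
      _ = _ := by
          rw [← ofReal_mul (by positivity), ← ofReal_mul (by positivity),
            ← ofReal_mul (by positivity)]
          congr 1
          have : 0 < (2 ^ k * ε) ^ ν := by positivity
          rw [show 2 ^ k * (4 * ε) = 4 * (2 ^ k * ε) by ring,
            Real.mul_rpow (x := 4) (by norm_num) (by positivity)]
          field_simp
  refine le_of_tendsto hsum.tendsto_sum_nat.norm (Filter.Eventually.of_forall fun n => ?_)
  calc _ ≤ ∑ k ∈ Finset.range n, CK * c₂ * 4 ^ ν * CP * (2 ^ k * (4 * ε) * v k) :=
        norm_sum_le_of_le _ fun k _ => hterm k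
    _ ≤ _ := by
        rw [← Finset.mul_sum]
        gcongr
        exact hS n

/-- A new pointwise inequality, Theorem 3 of the paper:
`T^*_K f (x) ≤ C · M_μ g (x)^{1 - q/ν} · ‖g‖_{M^{p,q}}^{q/ν}`. -/
theorem new_pointwise_inequality
    (μ : Measure X) (c₁ c₂ ν CK CP σ ρ' : ℝ) (K : X → X → ℝ) (f : X → ℝ) (g : X → ℝ≥0∞)
    (hc₁ : 0 < c₁) (hc₁₂ : c₁ ≤ c₂) (hν : 0 < ν) (hA : IsAhlfors μ c₁ c₂ ν)
    (hbal : (2 : ℝ) ^ (1 - ν) * (c₂ / c₁) < 1)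
    (hK : Measurable (Function.uncurry K)) (hCK : 0 < CK)
    (hsize : SizeCond K CK ν) (hnull : NullCond μ K)
    (hf : LocallyIntegrable f μ) (hg : LocIntE μ g)
    (hρ'1 : 1 < ρ') (hρ'ν : ρ' < ν) (hCP : 0 < CP) (hσ : 1 ≤ σ)
    (hPS : PoincareSobolev μ f g ρ' CP σ)
    (p q : ℝ) (hp : 1 < p) (hpq : p ≤ q) (hqν : q / ν < 1)
    (hgM : morreyNorm μ p q g < ∞) :
    ∃ C : ℝ, 0 < C ∧ ∀ x : X,
      maxT μ K f x ≤
        ENNReal.ofReal C * maximalFn μ g x ^ (1 - q / ν) * morreyNorm μ p q g ^ (q / ν) := by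
  have hq : 0 < q := by linarith
  have hc₂ : 0 < c₂ := hc₁.trans_le hc₁₂
  have hσ0 : 0 < σ := by linarith
  have hqν0 : 0 < q / ν := by positivity
  have ha : 1 < ν / q := by rwa [one_lt_div hq, ← div_lt_one hν]
  have hinv : 1 / (ν / q) = q / ν := one_div_div ν q
  set A : ℝ := 2 + (1 - 2 ^ (-(ν / q - 1)))⁻¹ with hAdef
  have hApos : 0 < A := by
    have : (2 : ℝ) ^ (-(ν / q - 1)) < 1 :=
      Real.rpow_lt_one_of_one_lt_of_neg one_lt_two (by linarith)
    have : 0 < (1 - (2 : ℝ) ^ (-(ν / q - 1)))⁻¹ := inv_pos.2 (by linarith)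
    positivity
  set D : ℝ := CK * c₂ * 4 ^ ν * CP with hD
  have hDpos : 0 < D := by positivity
  set N := morreyNorm μ p q g with hN
  set b : ℝ := c₁ ^ (-(1 / q)) with hb
  have hbpos : 0 < b := by positivity
  have hC : 0 < D * (A * b ^ (q / ν)) := by positivity
  refine ⟨D * (A * b ^ (q / ν)), hC, fun x => ?_⟩
  rcases eq_or_ne N 0 with hN0 | hN0
  · -- All averages of `g` vanish.
    refine iSup₂_le fun ε hε => ?_
    have := abs_truncT_le (v := 0) (S := 0) hc₁ hc₂.le hν.le hA hK hCK.le hsize hnull hρ'1 hCP.le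
      hPS x hε (fun k => le_rfl) (fun k => ?_) (fun n => by simp)
    · rw [mul_zero] at this
      simp [ofReal_of_nonpos this]
    · refine (hA.average_le_morreyNorm hc₁ hp hq g x (by positivity)).trans ?_
      simp [← hN, hN0]
  rcases eq_or_ne (maximalFn μ g x) ∞ with hM | hM
  · have h1 : N ^ (q / ν) ≠ 0 := by simp [hN0, hgM.ne]
    have h2 : ENNReal.ofReal (D * (A * b ^ (q / ν))) ≠ 0 := (ofReal_pos.2 hC).ne'
    rw [hM, top_rpow_of_pos (by linarith), mul_top h2, top_mul h1]
    exact le_top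
  set m := (maximalFn μ g x).toReal with hm
  have hmM : ENNReal.ofReal m = maximalFn μ g x := ofReal_toReal hM
  have hNN : ENNReal.ofReal N.toReal = N := ofReal_toReal hgM.ne
  refine iSup₂_le fun ε hε => ?_
  have havg (k : ℕ) : (μ (ball x (σ * (2 ^ k * (4 * ε)))))⁻¹ *
      ∫⁻ y in ball x (σ * (2 ^ k * (4 * ε))), g y ∂μ ≤
        ENNReal.ofReal (min m (b * N.toReal * (2 ^ k * (4 * ε)) ^ (-(ν / q)))) := by
    have hr : 0 < 2 ^ k * (4 * ε) := by positivity
    rw [ENNReal.ofReal_min, hmM]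
    refine le_min (le_maximalFn μ g x (by positivity)) ?_
    refine (hA.average_le_morreyNorm hc₁ hp hq g x (by positivity)).trans ?_
    rw [← hN]
    nth_rw 1 [← hNN]
    rw [← ofReal_mul (by positivity)]
    refine ofReal_le_ofReal ?_
    rw [mul_right_comm, Real.mul_rpow hc₁.le (by positivity), ← Real.rpow_mul (by positivity),
      show ν * -(1 / q) = -(ν / q) by ring]
    gcongr ?_ * ?_
    gcongr ?_ * ?_
    exact Real.rpow_le_rpow_of_nonpos hr (le_mul_of_one_le_left hr.le hσ)
      (neg_nonpos.2 (by positivity))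
  have hm0 : 0 ≤ m := toReal_nonneg
  have key := abs_truncT_le hc₁ hc₂.le hν.le hA hK hCK.le hsize hnull hρ'1 hCP.le
    hPS x hε (fun k => by positivity) havg
    (sum_two_pow_mul_le_interpolation ha hm0 (by positivity) (by positivity)
      (fun k => min_le_left _ _) fun k => min_le_right _ _)
  rw [hinv, Real.mul_rpow hbpos.le toReal_nonneg] at key
  refine (ofReal_le_ofReal key).trans_eq ?_
  rw [← hmM, ofReal_rpow_of_nonneg hm0 (by linarith)]
  nth_rw 2 [← hNN]
  rw [ofReal_rpow_of_nonneg toReal_nonneg hqν0.le, ← ofReal_mul hC.le, ← ofReal_mul (by positivity)]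
  congr 1
  ring
end

section
/- Let (X, d, μ) be a metric measure space whose measure is Ahlfors ν-regular with constants 0 < c₁ ≤ c₂ < ∞ satisfying 2^{1−ν}·(c₂/c₁) < 1, let σ > 0, let x ∈ X and let g : X → [0,∞] be measurable. Then the dyadic sum S = Σ_{k ∈ ℤ} 2^k · (1/μ(B(x, σ·2^k))) ∫_{B(x, σ·2^k)} g(y) dμ(y) satisfies S ≤ (2/σ) · (1 − 2^{1−ν}·(c₂/c₁))^{−1} · R_{1,μ}(g)(x), where both sides are interpreted in [0,∞]. -/
open MeasureTheory Metric ENNReal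

variable {X : Type*} [MetricSpace X] [MeasurableSpace X] [BorelSpace X]

namespace IsAhlfors

variable {Y : Type*} [MetricSpace Y] [MeasurableSpace Y] {μ : Measure Y} {c₁ c₂ ν : ℝ}

theorem measure_ball_ne_top (hA : IsAhlfors μ c₁ c₂ ν) (x : Y) {r : ℝ} (hr : 0 < r) :
    μ (ball x r) ≠ ∞ :=
  ((hA x r hr).2.trans_lt ofReal_lt_top).ne

theorem le_measureReal_ball (hA : IsAhlfors μ c₁ c₂ ν) (x : Y) {r : ℝ} (hr : 0 < r) :
    c₁ * r ^ ν ≤ μ.real (ball x r) :=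
  (ofReal_le_iff_le_toReal (hA.measure_ball_ne_top x hr)).1 (hA x r hr).1

theorem measureReal_ball_pos (hA : IsAhlfors μ c₁ c₂ ν) (hc₁ : 0 < c₁) (x : Y) {r : ℝ}
    (hr : 0 < r) : 0 < μ.real (ball x r) :=
  (by positivity : 0 < c₁ * r ^ ν).trans_le (hA.le_measureReal_ball x hr)

theorem measureReal_ball_le (hA : IsAhlfors μ c₁ c₂ ν) (hc₂ : 0 ≤ c₂) (x : Y) {r : ℝ}
    (hr : 0 < r) : μ.real (ball x r) ≤ c₂ * r ^ ν :=
  toReal_le_of_le_ofReal (by positivity) (hA x r hr).2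

theorem measure_singleton (hA : IsAhlfors μ c₁ c₂ ν) (hν : 0 < ν) (x : Y) : μ {x} = 0 := by
  have hlim : Filter.Tendsto (fun r : ℝ => ENNReal.ofReal (c₂ * r ^ ν))
      (nhdsWithin 0 (Set.Ioi 0)) (nhds 0) := by
    have h : Filter.Tendsto (fun r : ℝ => ENNReal.ofReal (c₂ * r ^ ν)) (nhds 0)
        (nhds (ENNReal.ofReal (c₂ * 0 ^ ν))) :=
      ((ENNReal.continuous_ofReal.tendsto _).comp
        ((Real.continuousAt_rpow_const 0 ν (Or.inr hν.le)).tendsto.const_mul c₂))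
    rw [Real.zero_rpow hν.ne', mul_zero, ofReal_zero] at h
    exact h.mono_left nhdsWithin_le_nhds
  refine nonpos_iff_eq_zero.1 (ge_of_tendsto hlim ?_)
  filter_upwards [self_mem_nhdsWithin] with r hr
  exact (measure_mono (Set.singleton_subset_iff.2 (mem_ball_self hr))).trans (hA x r hr).2

/-- Growth of balls under dyadic dilation. -/
theorem measureReal_ball_mul_two_pow_le (hA : IsAhlfors μ c₁ c₂ ν) (hc₁ : 0 < c₁)
    (hc₁₂ : c₁ ≤ c₂) (x : Y) {r : ℝ} (hr : 0 < r) (j : ℕ) :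
    μ.real (ball x r) * 2 ^ j ≤
      ((2 : ℝ) ^ (1 - ν) * (c₂ / c₁)) ^ j * μ.real (ball x (r * 2 ^ j)) := by
  rcases Nat.eq_zero_or_pos j with rfl | hj
  · simp
  have hc₂ : 0 < c₂ := hc₁.trans_le hc₁₂
  have hratio : c₂ / c₁ ≤ (c₂ / c₁) ^ j :=
    le_self_pow₀ ((one_le_div hc₁).2 hc₁₂) hj.ne'
  have hpow : ((2 : ℝ) ^ (1 - ν)) ^ j * (2 ^ j) ^ ν = 2 ^ j := by
    rw [← Real.rpow_natCast, ← Real.rpow_natCast, ← Real.rpow_mul two_pos.le,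
      ← Real.rpow_mul two_pos.le, ← Real.rpow_add two_pos]
    congr 1
    ring
  calc μ.real (ball x r) * 2 ^ j
      ≤ c₂ * r ^ ν * 2 ^ j := by gcongr; exact hA.measureReal_ball_le hc₂.le x hr
    _ = ((2 : ℝ) ^ (1 - ν)) ^ j * (c₂ / c₁) * (c₁ * (r * 2 ^ j) ^ ν) := by
        rw [Real.mul_rpow hr.le (by positivity)]
        field_simp
        linear_combination (-1 : ℝ) * hpow
    _ ≤ ((2 : ℝ) ^ (1 - ν)) ^ j * (c₂ / c₁) ^ j * μ.real (ball x (r * 2 ^ j)) := by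
        gcongr
        exact hA.le_measureReal_ball x (by positivity)
    _ = _ := by rw [mul_pow]

/-- The dyadic kernel is dominated by the Riesz kernel off the diagonal. -/
theorem tsum_dyadic_kernel_le (hA : IsAhlfors μ c₁ c₂ ν) (hc₁ : 0 < c₁) (hc₁₂ : c₁ ≤ c₂)
    (hbal : (2 : ℝ) ^ (1 - ν) * (c₂ / c₁) < 1) {σ : ℝ} (hσ : 0 < σ) (x : Y) {d : ℝ}
    (hd : 0 < d) :
    ∑' k : ℤ, (if d < σ * 2 ^ k then
        ENNReal.ofReal ((2 : ℝ) ^ k) * (μ (ball x (σ * 2 ^ k)))⁻¹ else 0)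
      ≤ ENNReal.ofReal ((2 / σ) * (1 - (2 : ℝ) ^ (1 - ν) * (c₂ / c₁))⁻¹) *
          (ENNReal.ofReal d / μ (ball x d)) := by
  set θ : ℝ := (2 : ℝ) ^ (1 - ν) * (c₂ / c₁) with hθ
  have hc₂ : 0 < c₂ := hc₁.trans_le hc₁₂
  have hθ₀ : 0 < θ := by positivity
  obtain ⟨n, hn₁, hn₂⟩ := exists_mem_Ico_zpow (div_pos hd hσ) _root_.one_lt_two
  rw [le_div_iff₀' hσ] at hn₁
  rw [div_lt_iff₀' hσ] at hn₂
  have hinj : Function.Injective fun j : ℕ => n + 1 + (j : ℤ) := fun a b h => by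
    simpa using h
  have hsupp : Function.support (fun k : ℤ => if d < σ * 2 ^ k then
      ENNReal.ofReal ((2 : ℝ) ^ k) * (μ (ball x (σ * 2 ^ k)))⁻¹ else 0) ⊆
      Set.range fun j : ℕ => n + 1 + (j : ℤ) := by
    intro k hk
    have hdk : d < σ * 2 ^ k := by
      by_contra h
      exact hk (if_neg h)
    have hnk : n < k :=
      (zpow_lt_zpow_iff_right₀ _root_.one_lt_two).1 (lt_of_mul_lt_mul_left (hn₁.trans_lt hdk) hσ.le)
    exact ⟨(k - (n + 1)).toNat, by dsimp only; omega⟩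
  rw [← hinj.tsum_eq hsupp]
  have hterm (j : ℕ) : (if d < σ * 2 ^ (n + 1 + (j : ℤ)) then
      ENNReal.ofReal ((2 : ℝ) ^ (n + 1 + (j : ℤ))) *
        (μ (ball x (σ * 2 ^ (n + 1 + (j : ℤ)))))⁻¹ else 0) ≤
      ENNReal.ofReal (2 / σ) * (ENNReal.ofReal d / μ (ball x d)) * ENNReal.ofReal θ ^ j := by
    refine (ite_le_sup _ _ _).trans (sup_le ?_ zero_le)
    have hr : 0 < σ * (2 : ℝ) ^ (n + 1) := by positivity
    have hk : (2 : ℝ) ^ (n + 1 + (j : ℤ)) = 2 ^ (n + 1) * 2 ^ j := by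
      rw [zpow_add₀ two_ne_zero (n + 1), zpow_natCast]
    rw [hk, ← mul_assoc σ]
    set r : ℝ := σ * 2 ^ (n + 1) with hr_def
    have hrj : 0 < r * 2 ^ j := by positivity
    have hr₂ : (2 : ℝ) ^ (n + 1) ≤ 2 / σ * d := by
      rw [zpow_add_one₀ two_ne_zero, div_mul_eq_mul_div, le_div_iff₀ hσ]
      linarith
    have hm := hA.measureReal_ball_mul_two_pow_le hc₁ hc₁₂ x hr j
    rw [← hθ] at hm
    have hdr : μ.real (ball x d) ≤ μ.real (ball x r) :=
      measureReal_mono (ball_subset_ball hn₂.le) (hA.measure_ball_ne_top x hr)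
    have hd₀ := hA.measureReal_ball_pos hc₁ x hd
    have hrj₀ := hA.measureReal_ball_pos hc₁ x hrj
    rw [← ofReal_measureReal (hA.measure_ball_ne_top x hd),
      ← ofReal_measureReal (hA.measure_ball_ne_top x hrj), ← ofReal_inv_of_pos hrj₀,
      ← ofReal_div_of_pos hd₀, ← ofReal_pow hθ₀.le, ← ofReal_mul (by positivity),
      ← ofReal_mul (by positivity), ← ofReal_mul (by positivity)]
    refine ofReal_le_ofReal ?_
    rw [← div_eq_mul_inv, ← mul_div_assoc, div_mul_eq_mul_div, div_le_div_iff₀ hrj₀ hd₀]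
    calc (2 : ℝ) ^ (n + 1) * 2 ^ j * μ.real (ball x d)
        = 2 ^ (n + 1) * (μ.real (ball x d) * 2 ^ j) := by ring
      _ ≤ 2 / σ * d * (θ ^ j * μ.real (ball x (r * 2 ^ j))) := by
          refine mul_le_mul hr₂ ?_ (by positivity) (by positivity)
          exact (mul_le_mul_of_nonneg_right hdr (by positivity)).trans hm
      _ = _ := by ring
  refine (ENNReal.tsum_le_tsum hterm).trans_eq ?_
  rw [ENNReal.tsum_mul_left, ENNReal.tsum_geometric, ← ofReal_one, ← ofReal_sub _ hθ₀.le,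
    ← ofReal_inv_of_pos (sub_pos.2 hbal), ofReal_mul (by positivity)]
  ring

end IsAhlfors

/-- estimate of the sum `𝒮` in the proof of Theorem 1: under the balance
condition `2^{1-ν} c₂/c₁ < 1`, the dyadic sum is bounded by a multiple of `R_{1,μ}(g)(x)`. -/
theorem dyadic_sum_le_riesz
    (μ : Measure X) (c₁ c₂ ν : ℝ)
    (hc₁ : 0 < c₁) (hc₁₂ : c₁ ≤ c₂) (hν : 0 < ν) (hA : IsAhlfors μ c₁ c₂ ν)
    (hbal : (2 : ℝ) ^ (1 - ν) * (c₂ / c₁) < 1)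
    (σ : ℝ) (hσ : 0 < σ) (x : X) (g : X → ℝ≥0∞) (hg : Measurable g) :
    ∑' k : ℤ,
        ENNReal.ofReal ((2 : ℝ) ^ k) *
          ((μ (ball x (σ * 2 ^ k)))⁻¹ * ∫⁻ y in ball x (σ * 2 ^ k), g y ∂μ)
      ≤ ENNReal.ofReal ((2 / σ) * (1 - (2 : ℝ) ^ (1 - ν) * (c₂ / c₁))⁻¹) *
          rieszPot μ 1 g x := by
  have hmeas (k : ℤ) : Measurable ((ball x (σ * 2 ^ k)).indicator g) :=
    hg.indicator measurableSet_ball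
  simp_rw [← lintegral_indicator measurableSet_ball, ← mul_assoc,
    ← lintegral_const_mul _ (hmeas _)]
  rw [← lintegral_tsum fun k => ((hmeas k).const_mul _).aemeasurable, rieszPot,
    ← lintegral_const_mul' _ _ ofReal_ne_top]
  refine lintegral_mono_ae ?_
  filter_upwards [measure_eq_zero_iff_ae_notMem.1 (hA.measure_singleton hν x)] with y hy
  have hd : 0 < dist x y := dist_pos.2 fun h => hy h.symm
  rw [Real.rpow_one, ← mul_assoc]
  refine le_trans (le_of_eq ?_)
    (mul_le_mul_left (hA.tsum_dyadic_kernel_le hc₁ hc₁₂ hbal hσ x hd) (g y))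
  rw [← ENNReal.tsum_mul_right]
  refine tsum_congr fun k => ?_
  by_cases hk : dist x y < σ * 2 ^ k
  · rw [if_pos hk, Set.indicator_of_mem (mem_ball'.2 hk)]
  · rw [if_neg hk, Set.indicator_of_notMem (mt mem_ball'.1 hk), mul_zero, zero_mul]
end

section
/- Let (X, d, μ) be a metric measure space whose measure is Ahlfors ν-regular with constants 0 < c₁ ≤ c₂ < ∞, let 0 < s < ν and let R₀ > 0. Then for every locally integrable f : X → ℝ and every x ∈ X, ∫_{{y : d(x,y) < R₀}} (d(x,y)^s / μ(B(x, d(x,y)))) |f(y)| dμ(y) ≤ C · R₀^s · M_μ(f)(x), where C = (2^ν · c₂/c₁) · (1 − 2^{−s})^{−1}. -/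
open MeasureTheory Metric ENNReal

variable {X : Type*} [MetricSpace X] [MeasurableSpace X] [BorelSpace X]

/-- Points of a punctured open ball of radius `R` lie in a half-open dyadic annulus. -/
theorem exists_dyadic_annulus {t R : ℝ} (ht : 0 < t) (htR : t < R) :
    ∃ k : ℕ, R * (1 / 2) ^ (k + 1) ≤ t ∧ t < R * (1 / 2) ^ k := by
  have hR : 0 < R := ht.trans htR
  have hex : ∃ k : ℕ, R * (1 / 2) ^ (k + 1) ≤ t := by
    obtain ⟨n, hn⟩ := exists_pow_lt_of_lt_one (div_pos ht hR) (by norm_num : (1 / 2 : ℝ) < 1)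
    refine ⟨n, ?_⟩
    rw [lt_div_iff₀ hR] at hn
    have hpos : 0 < R * (1 / 2 : ℝ) ^ n := by positivity
    rw [pow_succ]
    linarith
  classical
  refine ⟨Nat.find hex, Nat.find_spec hex, ?_⟩
  rcases h : Nat.find hex with _ | m
  · simpa using htR
  · exact not_le.1 (Nat.find_min hex (h ▸ Nat.lt_succ_self m))

/-- The integral over a ball is at most its measure times the maximal function at the centre. -/
theorem setLIntegral_ball_le_maximalFn (μ : Measure X) (g : X → ℝ≥0∞) (x : X) {r : ℝ}
    (hr : 0 < r) (h0 : μ (ball x r) ≠ 0) (htop : μ (ball x r) ≠ ∞) :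
    ∫⁻ y in ball x r, g y ∂μ ≤ μ (ball x r) * maximalFn μ g x := by
  have h : (μ (ball x r))⁻¹ * ∫⁻ y in ball x r, g y ∂μ ≤ maximalFn μ g x :=
    le_iSup_of_le x <| le_iSup_of_le r <| le_iSup_of_le hr <|
      le_iSup_of_le (mem_ball_self hr) le_rfl
  calc ∫⁻ y in ball x r, g y ∂μ
      = μ (ball x r) * ((μ (ball x r))⁻¹ * ∫⁻ y in ball x r, g y ∂μ) := by
        rw [← mul_assoc, ENNReal.mul_inv_cancel h0 htop, one_mul]
    _ ≤ _ := by gcongr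

/-- The contribution of the annulus `r / 2 ≤ d(x,y) < r` to the Riesz potential. -/
theorem setLIntegral_annulus_riesz_le {μ : Measure X} {c₁ c₂ ν s r : ℝ}
    (hc₁ : 0 < c₁) (hν : 0 ≤ ν) (hA : IsAhlfors μ c₁ c₂ ν)
    (hs : 0 ≤ s) (hr : 0 < r) (g : X → ℝ≥0∞) (x : X) :
    ∫⁻ y in {y | r / 2 ≤ dist x y ∧ dist x y < r},
        (ENNReal.ofReal (dist x y ^ s) / μ (ball x (dist x y))) * g y ∂μ
      ≤ ENNReal.ofReal ((2 : ℝ) ^ ν * c₂ / c₁ * r ^ s) * maximalFn μ g x := by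
  have hmeas : MeasurableSet {y | r / 2 ≤ dist x y ∧ dist x y < r} := by
    have hc : Continuous fun y => dist x y := by fun_prop
    exact (isClosed_le continuous_const hc).measurableSet.inter
      (isOpen_lt hc continuous_const).measurableSet
  have hb : 0 < c₁ * (r / 2) ^ ν := by positivity
  have h0 : μ (ball x r) ≠ 0 :=
    ((ENNReal.ofReal_pos.2 (by positivity)).trans_le (hA x r hr).1).ne'
  have htop : μ (ball x r) ≠ ∞ := ((hA x r hr).2.trans_lt ENNReal.ofReal_lt_top).ne
  calc _ ≤ ∫⁻ y in {y | r / 2 ≤ dist x y ∧ dist x y < r},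
        ENNReal.ofReal (r ^ s / (c₁ * (r / 2) ^ ν)) * g y ∂μ := by
        refine setLIntegral_mono' hmeas fun y ⟨hy₁, hy₂⟩ => ?_
        have hd : 0 < dist x y := (half_pos hr).trans_le hy₁
        rw [ENNReal.ofReal_div_of_pos hb]
        gcongr
        refine le_trans (ENNReal.ofReal_le_ofReal ?_) (hA x _ hd).1
        gcongr
    _ = ENNReal.ofReal (r ^ s / (c₁ * (r / 2) ^ ν)) *
        ∫⁻ y in {y | r / 2 ≤ dist x y ∧ dist x y < r}, g y ∂μ :=
        lintegral_const_mul' _ _ ENNReal.ofReal_ne_top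
    _ ≤ ENNReal.ofReal (r ^ s / (c₁ * (r / 2) ^ ν)) * ∫⁻ y in ball x r, g y ∂μ := by
        gcongr
        intro y hy
        exact mem_ball'.2 hy.2
    _ ≤ ENNReal.ofReal (r ^ s / (c₁ * (r / 2) ^ ν)) *
        (ENNReal.ofReal (c₂ * r ^ ν) * maximalFn μ g x) := by
        gcongr
        exact (setLIntegral_ball_le_maximalFn μ g x hr h0 htop).trans
          (by gcongr; exact (hA x r hr).2)
    _ = _ := by
        rw [← mul_assoc, ← ENNReal.ofReal_mul (by positivity)]
        congr 2
        have : r ^ ν ≠ 0 := by positivity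
        rw [Real.div_rpow hr.le two_pos.le]
        field_simp

/-- estimate of `R₁` in the proof of Theorem 2: the local part of the
Riesz potential is bounded by `C · R₀^s · M_μ f (x)` with
`C = (2^ν c₂/c₁) · (1 - 2^{-s})⁻¹`. -/
theorem riesz_local_part_le_maximal
    (μ : Measure X) (c₁ c₂ ν s R₀ : ℝ)
    (hc₁ : 0 < c₁) (hc₁₂ : c₁ ≤ c₂) (hν : 0 < ν) (hA : IsAhlfors μ c₁ c₂ ν)
    (hs : 0 < s) (hsν : s < ν) (hR₀ : 0 < R₀)
    (f : X → ℝ) (hf : LocallyIntegrable f μ) (x : X) :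
    ∫⁻ y in {y | dist x y < R₀},
        (ENNReal.ofReal (dist x y ^ s) / μ (ball x (dist x y))) * ENNReal.ofReal |f y| ∂μ
      ≤ ENNReal.ofReal ((2 : ℝ) ^ ν * c₂ / c₁ * (1 - (2 : ℝ) ^ (-s))⁻¹ * R₀ ^ s) *
          maximalFn μ (fun y => ENNReal.ofReal |f y|) x := by
  have hc₂ : 0 ≤ c₂ := hc₁.le.trans hc₁₂
  set g : X → ℝ≥0∞ := fun y => ENNReal.ofReal |f y|
  set F : X → ℝ≥0∞ := fun y =>
    (ENNReal.ofReal (dist x y ^ s) / μ (ball x (dist x y))) * g y with hF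
  set r : ℕ → ℝ := fun k => R₀ * (1 / 2) ^ k with hr_def
  have hr : ∀ k, 0 < r k := fun k => by positivity
  set S : ℕ → Set X := fun k => {y | r k / 2 ≤ dist x y ∧ dist x y < r k} with hS
  have hcover : {y | dist x y < R₀} ⊆ {x} ∪ ⋃ k, S k := by
    intro y hy
    rcases eq_or_ne x y with rfl | hxy
    · exact Or.inl rfl
    · obtain ⟨k, hk₁, hk₂⟩ := exists_dyadic_annulus (dist_pos.2 hxy) hy
      refine Or.inr (Set.mem_iUnion.2 ⟨k, le_of_eq_of_le ?_ hk₁, hk₂⟩)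
      simp only [hr_def]
      ring
  have hpoint : ∫⁻ y in {x}, F y ∂μ = 0 := by
    simp [hF, Real.zero_rpow hs.ne']
  set q : ℝ := (2 : ℝ) ^ (-s) with hq_def
  have hq0 : 0 ≤ q := by positivity
  have hq1 : q < 1 := Real.rpow_lt_one_of_one_lt_of_neg one_lt_two (neg_lt_zero.2 hs)
  have hrs : ∀ k, r k ^ s = R₀ ^ s * q ^ k := fun k => by
    simp only [hr_def, hq_def]
    rw [Real.mul_rpow hR₀.le (by positivity), ← Real.rpow_pow_comm (by norm_num), one_div,
      Real.inv_rpow two_pos.le, ← Real.rpow_neg two_pos.le]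
  have hsum : HasSum (fun k => (2 : ℝ) ^ ν * c₂ / c₁ * r k ^ s)
      ((2 : ℝ) ^ ν * c₂ / c₁ * (1 - q)⁻¹ * R₀ ^ s) := by
    simp only [hrs, ← mul_assoc]
    rw [mul_right_comm]
    exact (hasSum_geometric_of_lt_one hq0 hq1).mul_left _
  calc ∫⁻ y in {y | dist x y < R₀}, F y ∂μ
      ≤ ∫⁻ y in {x} ∪ ⋃ k, S k, F y ∂μ := lintegral_mono_set hcover
    _ ≤ ∫⁻ y in {x}, F y ∂μ + ∫⁻ y in ⋃ k, S k, F y ∂μ := lintegral_union_le _ _ _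
    _ ≤ ∑' k, ∫⁻ y in S k, F y ∂μ := by
        rw [hpoint, zero_add]
        exact lintegral_iUnion_le _ _
    _ ≤ ∑' k, ENNReal.ofReal ((2 : ℝ) ^ ν * c₂ / c₁ * r k ^ s) * maximalFn μ g x :=
        ENNReal.tsum_le_tsum fun k =>
          setLIntegral_annulus_riesz_le hc₁ hν.le hA hs.le (hr k) g x
    _ = _ := by
        rw [ENNReal.tsum_mul_right, ← hsum.tsum_eq,
          ENNReal.ofReal_tsum_of_nonneg (fun k => by have := hr k; positivity) hsum.summable]
end

section
/- Let (X, d, μ) be a metric measure space whose measure is Ahlfors ν-regular with constants 0 < c₁ ≤ c₂ < ∞ satisfying 2^{1−ν}·(c₂/c₁) < 1, and let K be a kernel satisfying the size condition and the pseudo-radial null condition. Let f : X → ℝ be locally integrable and let g : X → [0,∞] be locally integrable such that the pair (f, g) satisfies a weak (1, ρ')-Poincaré–Sobolev inequality for some 1 < ρ' < ν. Let 1 < q < ν with g ∈ L^q(μ) and set r = qν/(ν − q). Then there is a constant C such that the Sobolev-type inequality ‖T*_K f‖_{L^r(μ)} ≤ C · ‖g‖_{L^q(μ)} holds. -/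
open MeasureTheory Metric ENNReal

variable {X : Type*} [MetricSpace X] [MeasurableSpace X] [BorelSpace X]

/-- Centered maximal function normalised by `r ^ ν` instead of the measure of the ball. -/
noncomputable def growthMax (μ : Measure X) (ν : ℝ) (g : X → ℝ≥0∞) (x : X) : ℝ≥0∞ :=
  ⨆ (r : ℝ) (_ : 0 < r), (ENNReal.ofReal (r ^ ν))⁻¹ * ∫⁻ y in ball x r, g y ∂μ

omit [BorelSpace X] in
theorem le_growthMax (μ : Measure X) (ν : ℝ) (g : X → ℝ≥0∞) (x : X) {r : ℝ} (hr : 0 < r) :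
    (ENNReal.ofReal (r ^ ν))⁻¹ * ∫⁻ y in ball x r, g y ∂μ ≤ growthMax μ ν g x :=
  le_iSup₂ (f := fun (r : ℝ) (_ : 0 < r) =>
    (ENNReal.ofReal (r ^ ν))⁻¹ * ∫⁻ y in ball x r, g y ∂μ) r hr

theorem mul_meas_lt_growthMax_le {μ : Measure X} {c ν : ℝ} (hc : 0 < c) (hν : 0 < ν)
    (hU : ∀ (x : X) (r : ℝ), 0 < r → μ (ball x r) ≤ ENNReal.ofReal (c * r ^ ν))
    (g : X → ℝ≥0∞) {t : ℝ≥0∞} (ht0 : t ≠ 0) (ht : t ≠ ∞) :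
    t * μ {x | t < growthMax μ ν g x} ≤ ENNReal.ofReal (c * 6 ^ ν) * ∫⁻ x, g x ∂μ := by
  have hC : ENNReal.ofReal (c * 6 ^ ν) ≠ 0 := by
    rw [Ne, ENNReal.ofReal_eq_zero, not_le]; positivity
  by_cases hI : ∫⁻ x, g x ∂μ = ∞
  · rw [hI, ENNReal.mul_top hC]; exact le_top
  set S := {x | t < growthMax μ ν g x} with hS
  have hex : ∀ x ∈ S, ∃ r : ℝ, 0 < r ∧ t * ENNReal.ofReal (r ^ ν) < ∫⁻ y in ball x r, g y ∂μ := by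
    intro x hx
    simp only [hS, Set.mem_ofPred_eq, growthMax, lt_iSup_iff] at hx
    obtain ⟨r, hr, h⟩ := hx
    refine ⟨r, hr, ?_⟩
    rw [mul_comm, ← div_eq_mul_inv] at h
    exact (ENNReal.lt_div_iff_mul_lt
      (Or.inl (by rw [Ne, ENNReal.ofReal_eq_zero, not_le]; positivity))
      (Or.inl ENNReal.ofReal_ne_top)).1 h
  choose! r hr0 hr using hex
  have hbound : ∀ x ∈ S, r x ≤ ((∫⁻ x, g x ∂μ) / t).toReal ^ (1 / ν) := by
    intro x hx
    have h1 : ENNReal.ofReal (r x ^ ν) ≤ (∫⁻ x, g x ∂μ) / t := by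
      rw [ENNReal.le_div_iff_mul_le (Or.inl ht0) (Or.inl ht), mul_comm]
      exact (hr x hx).le.trans (setLIntegral_le_lintegral _ _)
    have h2 := (ENNReal.ofReal_le_iff_le_toReal (ENNReal.div_ne_top hI ht0)).1 h1
    have h3 := Real.rpow_le_rpow (Real.rpow_nonneg (hr0 x hx).le _) h2
      (one_div_nonneg.2 hν.le)
    rwa [one_div, Real.rpow_rpow_inv (hr0 x hx).le hν.ne', ← one_div] at h3
  obtain ⟨u, huS, hdisj, hcov⟩ :=
    Vitali.exists_disjoint_subfamily_covering_enlargement_closedBall S (fun x => x) r _ hbound 5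
      (by norm_num)
  have hsum : ∑' b : u, t * ENNReal.ofReal (r b ^ ν) ≤ ∫⁻ x, g x ∂μ := by
    calc ∑' b : u, t * ENNReal.ofReal (r b ^ ν)
        ≤ ∑' b : u, μ.withDensity g (ball (b : X) (r b)) := by
          refine ENNReal.tsum_le_tsum fun b => ?_
          rw [withDensity_apply _ measurableSet_ball]
          exact (hr b (huS b.2)).le
      _ ≤ μ.withDensity g (⋃ b : u, ball (b : X) (r b)) := by
          refine tsum_meas_le_meas_iUnion_of_disjoint _ (fun _ => measurableSet_ball) ?_
          intro a b hab
          exact (hdisj a.2 b.2 (fun h => hab (Subtype.ext h))).mono ball_subset_closedBall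
            ball_subset_closedBall
      _ ≤ μ.withDensity g Set.univ := measure_mono (Set.subset_univ _)
      _ = ∫⁻ x, g x ∂μ := by rw [withDensity_apply _ MeasurableSet.univ, setLIntegral_univ]
  have hcount : u.Countable := by
    have h := Summable.countable_support_ennreal (ne_top_of_le_ne_top hI hsum)
    have h' : (Function.support fun b : u => t * ENNReal.ofReal (r b ^ ν)) = Set.univ := by
      refine Set.eq_univ_of_forall fun b => ?_
      have := hr0 b (huS b.2)
      exact mul_ne_zero ht0 (by rw [Ne, ENNReal.ofReal_eq_zero, not_le]; positivity)
    rw [h'] at h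
    exact Set.countable_coe_iff.1 (Set.countable_univ_iff.1 h)
  have : Countable u := hcount.to_subtype
  have hsub : S ⊆ ⋃ b : u, ball (b : X) (6 * r b) := by
    intro x hx
    obtain ⟨b, hb, hxb⟩ := hcov x hx
    refine Set.mem_iUnion.2 ⟨⟨b, hb⟩, ?_⟩
    have h0 := hr0 b (huS hb)
    exact closedBall_subset_ball (by linarith) (hxb (mem_closedBall_self (hr0 x hx).le))
  calc t * μ S ≤ t * ∑' b : u, μ (ball (b : X) (6 * r b)) := by
        gcongr; exact (measure_mono hsub).trans (measure_iUnion_le _)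
    _ ≤ t * ∑' b : u, ENNReal.ofReal (c * 6 ^ ν) * ENNReal.ofReal (r b ^ ν) := by
        gcongr with b
        have h0 := hr0 b (huS b.2)
        refine (hU _ _ (by linarith)).trans_eq ?_
        rw [← ENNReal.ofReal_mul (by positivity), Real.mul_rpow (by norm_num) h0.le, mul_assoc]
    _ = ENNReal.ofReal (c * 6 ^ ν) * ∑' b : u, t * ENNReal.ofReal (r b ^ ν) := by
        rw [ENNReal.tsum_mul_left, ENNReal.tsum_mul_left]; ring
    _ ≤ _ := by gcongr

/-- Superlevel sets of the maximal function only see the part of `g` above a fraction of the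
level. -/
theorem mul_meas_lt_growthMax_le_setLIntegral {μ : Measure X} {c ν : ℝ} (hc : 0 < c) (hν : 0 < ν)
    (hU : ∀ (x : X) (r : ℝ), 0 < r → μ (ball x r) ≤ ENNReal.ofReal (c * r ^ ν))
    {g : X → ℝ≥0∞} (hg : Measurable g) {t : ℝ≥0∞} (ht0 : t ≠ 0) (ht : t ≠ ∞) :
    t * μ {x | t < growthMax μ ν g x} ≤
      2 * ENNReal.ofReal (c * 6 ^ ν) *
        ∫⁻ x in {x | t < ENNReal.ofReal (2 * c) * g x}, g x ∂μ := by
  set A := {x | t < ENNReal.ofReal (2 * c) * g x} with hA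
  have hAm : MeasurableSet A := measurableSet_lt measurable_const (hg.const_mul _)
  have hcc : ENNReal.ofReal c ≠ 0 := by rwa [Ne, ENNReal.ofReal_eq_zero, not_le]
  have hsplit : ∀ y, g y ≤ A.indicator g y + t / 2 * (ENNReal.ofReal c)⁻¹ := by
    intro y
    by_cases hy : y ∈ A
    · simp [hy]
    · have h : ENNReal.ofReal (2 * c) * g y ≤ t := not_lt.1 hy
      rw [Set.indicator_of_notMem hy, zero_add, ← div_eq_mul_inv,
        ENNReal.le_div_iff_mul_le (Or.inl hcc) (Or.inl ENNReal.ofReal_ne_top),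
        ENNReal.le_div_iff_mul_le (by simp) (by simp)]
      refine le_trans (le_of_eq ?_) h
      rw [ENNReal.ofReal_mul (by norm_num), ENNReal.ofReal_ofNat]; ring
  have hM : ∀ x, growthMax μ ν g x ≤ growthMax μ ν (A.indicator g) x + t / 2 := by
    intro x
    refine iSup₂_le fun r hr => ?_
    have hr' : ENNReal.ofReal (r ^ ν) ≠ 0 := by
      rw [Ne, ENNReal.ofReal_eq_zero, not_le]; positivity
    calc (ENNReal.ofReal (r ^ ν))⁻¹ * ∫⁻ y in ball x r, g y ∂μ
        ≤ (ENNReal.ofReal (r ^ ν))⁻¹ *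
            ∫⁻ y in ball x r, (A.indicator g y + t / 2 * (ENNReal.ofReal c)⁻¹) ∂μ := by
          gcongr with y; exact hsplit y
      _ = (ENNReal.ofReal (r ^ ν))⁻¹ * ∫⁻ y in ball x r, A.indicator g y ∂μ +
            (ENNReal.ofReal (r ^ ν))⁻¹ * (t / 2 * (ENNReal.ofReal c)⁻¹ * μ (ball x r)) := by
          rw [lintegral_add_right _ measurable_const, setLIntegral_const, mul_add]
      _ ≤ growthMax μ ν (A.indicator g) x +
            (ENNReal.ofReal (r ^ ν))⁻¹ * (t / 2 * (ENNReal.ofReal c)⁻¹ *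
              (ENNReal.ofReal c * ENNReal.ofReal (r ^ ν))) := by
          gcongr
          · exact le_growthMax μ ν _ x hr
          · rw [← ENNReal.ofReal_mul hc.le]; exact hU x r hr
      _ = growthMax μ ν (A.indicator g) x + t / 2 *
            ((ENNReal.ofReal c)⁻¹ * ENNReal.ofReal c) *
              ((ENNReal.ofReal (r ^ ν))⁻¹ * ENNReal.ofReal (r ^ ν)) := by ring
      _ = _ := by
          rw [ENNReal.inv_mul_cancel hcc ENNReal.ofReal_ne_top,
            ENNReal.inv_mul_cancel hr' ENNReal.ofReal_ne_top, mul_one, mul_one]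
  have hsub : {x | t < growthMax μ ν g x} ⊆ {x | t / 2 < growthMax μ ν (A.indicator g) x} := by
    intro x hx
    by_contra hcon
    have h1 : growthMax μ ν (A.indicator g) x ≤ t / 2 := not_lt.1 hcon
    have h2 := (hM x).trans (add_le_add_left h1 (t / 2))
    rw [ENNReal.add_halves] at h2
    exact absurd hx (not_lt.2 h2)
  have hw := mul_meas_lt_growthMax_le hc hν hU (A.indicator g) (t := t / 2)
    (by simp [ht0]) (ENNReal.div_ne_top ht (by norm_num))
  rw [lintegral_indicator hAm] at hw
  calc t * μ {x | t < growthMax μ ν g x}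
      ≤ (2 * (t / 2)) * μ {x | t / 2 < growthMax μ ν (A.indicator g) x} := by
        rw [ENNReal.mul_div_cancel (by norm_num) (by norm_num)]; gcongr
    _ = 2 * (t / 2 * μ {x | t / 2 < growthMax μ ν (A.indicator g) x}) := by ring
    _ ≤ 2 * (ENNReal.ofReal (c * 6 ^ ν) * ∫⁻ x in A, g x ∂μ) := by gcongr
    _ = _ := by ring

theorem rpow_le_tsum_dyadic {q : ℝ} (hq : 0 < q) (a : ℝ≥0∞) :
    a ^ q ≤ ∑' k : ℤ, if (2 : ℝ≥0∞) ^ k < a then ((2 : ℝ≥0∞) ^ (k + 1)) ^ q else 0 := by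
  rcases eq_or_ne a 0 with rfl | ha0
  · simp [hq]
  rcases eq_or_ne a ∞ with rfl | ha
  · have h2 : ∀ k : ℤ, (2 : ℝ≥0∞) ^ k < ∞ := fun k =>
      ENNReal.zpow_lt_top (by norm_num) (by norm_num) k
    have : ∑' k : ℕ, (1 : ℝ≥0∞) ≤
        ∑' k : ℤ, if (2 : ℝ≥0∞) ^ k < ∞ then ((2 : ℝ≥0∞) ^ (k + 1)) ^ q else 0 := by
      refine le_trans (ENNReal.tsum_le_tsum fun k : ℕ => ?_)
        (ENNReal.tsum_comp_le_tsum_of_injective Nat.cast_injective _)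
      rw [if_pos (h2 _)]
      refine ENNReal.one_le_rpow ?_ hq
      rw [← Nat.cast_succ, zpow_natCast]
      exact one_le_pow₀ (by norm_num)
    rw [ENNReal.tsum_const_eq_top_of_ne_zero one_ne_zero, top_le_iff] at this
    rw [this]; exact le_top
  · obtain ⟨n, hn1, hn2⟩ := ENNReal.exists_mem_Ioc_zpow ha0 ha (y := 2) (by norm_num) (by norm_num)
    refine le_trans ?_ (ENNReal.le_tsum n)
    rw [if_pos hn1]
    gcongr

theorem tsum_dyadic_le_rpow {p : ℝ} (hp : 0 < p) (b : ℝ≥0∞) :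
    ∑' k : ℤ, (if (2 : ℝ≥0∞) ^ k < b then ((2 : ℝ≥0∞) ^ k) ^ p else 0) ≤
      (1 - ((2 : ℝ≥0∞) ^ p)⁻¹)⁻¹ * b ^ p := by
  have h2p : (1 : ℝ≥0∞) < 2 ^ p := ENNReal.one_lt_rpow (by norm_num) hp
  rcases eq_or_ne b 0 with rfl | hb0
  · simp
  rcases eq_or_ne b ∞ with rfl | hb
  · rw [ENNReal.top_rpow_of_pos hp, ENNReal.mul_top]
    · exact le_top
    · rw [Ne, ENNReal.inv_eq_zero]
      exact (tsub_le_self.trans_lt ENNReal.one_lt_top).ne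
  · obtain ⟨n, hn1, hn2⟩ := ENNReal.exists_mem_Ioc_zpow hb0 hb (y := 2) (by norm_num) (by norm_num)
    rw [← (Equiv.subLeft n).tsum_eq, ← Nat.cast_injective.tsum_eq (g := ((↑) : ℕ → ℤ))]
    · calc _ ≤ ∑' j : ℕ, b ^ p * (((2 : ℝ≥0∞) ^ p)⁻¹) ^ j := by
            refine ENNReal.tsum_le_tsum fun j => ?_
            split_ifs
            · rw [Equiv.subLeft_apply, ENNReal.zpow_sub (by norm_num) (by norm_num),
                ENNReal.mul_rpow_of_nonneg _ _ hp.le, zpow_natCast, ENNReal.inv_rpow,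
                ← ENNReal.rpow_natCast, ← ENNReal.rpow_mul, mul_comm (j : ℝ), ENNReal.rpow_mul,
                ENNReal.rpow_natCast, ENNReal.inv_pow]
              gcongr
            · exact zero_le
        _ = _ := by rw [ENNReal.tsum_mul_left, ENNReal.tsum_geometric, mul_comm]
    · intro k hk
      by_contra hcon
      refine hk (if_neg ?_)
      rw [not_lt, Equiv.subLeft_apply]
      refine hn2.trans ?_
      have hk0 : k < 0 := by
        by_contra h
        exact hcon ⟨k.toNat, Int.toNat_of_nonneg (not_lt.1 h)⟩
      exact ENNReal.zpow_le_of_le (by norm_num) (by omega)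

theorem lintegral_growthMax_rpow_le {μ : Measure X} {c ν q : ℝ} (hc : 0 < c) (hν : 0 < ν)
    (hq : 1 < q)
    (hU : ∀ (x : X) (r : ℝ), 0 < r → μ (ball x r) ≤ ENNReal.ofReal (c * r ^ ν)) :
    ∃ C : ℝ≥0∞, C ≠ ∞ ∧ ∀ g : X → ℝ≥0∞, Measurable g →
      ∫⁻ x, growthMax μ ν g x ^ q ∂μ ≤ C * ∫⁻ x, g x ^ q ∂μ := by
  have hq0 : 0 < q - 1 := by linarith
  set D : ℝ≥0∞ := 2 ^ q * (2 * ENNReal.ofReal (c * 6 ^ ν)) with hD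
  set G : ℝ≥0∞ := (1 - ((2 : ℝ≥0∞) ^ (q - 1))⁻¹)⁻¹ with hG
  have hDt : D ≠ ∞ := ENNReal.mul_ne_top (ENNReal.rpow_ne_top_of_nonneg (by linarith) (by norm_num))
    (ENNReal.mul_ne_top (by norm_num) ENNReal.ofReal_ne_top)
  have hGt : G ≠ ∞ := by
    rw [hG, Ne, ENNReal.inv_eq_top, tsub_eq_zero_iff_le, not_le, ENNReal.inv_lt_one]
    exact ENNReal.one_lt_rpow (by norm_num) hq0
  refine ⟨D * (G * ENNReal.ofReal (2 * c) ^ (q - 1)), ?_, fun g hg => ?_⟩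
  · exact ENNReal.mul_ne_top hDt (ENNReal.mul_ne_top hGt
      (ENNReal.rpow_ne_top_of_nonneg hq0.le ENNReal.ofReal_ne_top))
  have h20 : ∀ k : ℤ, (2 : ℝ≥0∞) ^ k ≠ 0 := fun k =>
    (ENNReal.zpow_pos (by norm_num) (by norm_num) k).ne'
  have h2t : ∀ k : ℤ, (2 : ℝ≥0∞) ^ k ≠ ∞ := fun k =>
    (ENNReal.zpow_lt_top (by norm_num) (by norm_num) k).ne
  set E : ℤ → Set X := fun k => toMeasurable μ {x | 2 ^ k < growthMax μ ν g x} with hE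
  have hEm : ∀ k, MeasurableSet (E k) := fun k => measurableSet_toMeasurable _ _
  set A : ℤ → Set X := fun k => {x | 2 ^ k < ENNReal.ofReal (2 * c) * g x} with hA
  have hAm : ∀ k, MeasurableSet (A k) := fun k =>
    measurableSet_lt measurable_const (hg.const_mul _)
  have hterm : ∀ k : ℤ, ((2 : ℝ≥0∞) ^ (k + 1)) ^ q * μ (E k) ≤
      D * ∫⁻ x, (A k).indicator (fun x => ((2 : ℝ≥0∞) ^ k) ^ (q - 1) * g x) x ∂μ := by
    intro k
    have hw := mul_meas_lt_growthMax_le_setLIntegral hc hν hU hg (h20 k) (h2t k)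
    rw [hE, measure_toMeasurable, lintegral_indicator (hAm k), lintegral_const_mul _ hg]
    calc ((2 : ℝ≥0∞) ^ (k + 1)) ^ q * μ {x | 2 ^ k < growthMax μ ν g x}
        = 2 ^ q * ((2 : ℝ≥0∞) ^ k) ^ (q - 1) *
            ((2 : ℝ≥0∞) ^ k * μ {x | 2 ^ k < growthMax μ ν g x}) := by
          rw [ENNReal.zpow_add (by norm_num) (by norm_num), zpow_one,
            ENNReal.mul_rpow_of_nonneg _ _ (by linarith)]
          nth_rewrite 1 [show q = (q - 1) + 1 by ring]
          rw [ENNReal.rpow_add _ _ (h20 k) (h2t k), ENNReal.rpow_one]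
          ring
      _ ≤ 2 ^ q * ((2 : ℝ≥0∞) ^ k) ^ (q - 1) * (2 * ENNReal.ofReal (c * 6 ^ ν) *
            ∫⁻ x in A k, g x ∂μ) := by gcongr
      _ = _ := by rw [hD]; ring
  calc ∫⁻ x, growthMax μ ν g x ^ q ∂μ
      ≤ ∫⁻ x, ∑' k : ℤ, (E k).indicator (fun _ => ((2 : ℝ≥0∞) ^ (k + 1)) ^ q) x ∂μ := by
        refine lintegral_mono fun x => (rpow_le_tsum_dyadic (by linarith) _).trans ?_
        refine ENNReal.tsum_le_tsum fun k => ?_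
        split_ifs with h
        · rw [Set.indicator_of_mem (show x ∈ E k from subset_toMeasurable _ _ h)]
        · exact zero_le
    _ = ∑' k : ℤ, ((2 : ℝ≥0∞) ^ (k + 1)) ^ q * μ (E k) := by
        rw [lintegral_tsum fun k => (measurable_const.indicator (hEm k)).aemeasurable]
        simp_rw [lintegral_indicator_const (hEm _)]
    _ ≤ ∑' k : ℤ, D * ∫⁻ x, (A k).indicator (fun x => ((2 : ℝ≥0∞) ^ k) ^ (q - 1) * g x) x ∂μ :=
        ENNReal.tsum_le_tsum hterm
    _ = D * ∫⁻ x, ∑' k : ℤ, (A k).indicator (fun x => ((2 : ℝ≥0∞) ^ k) ^ (q - 1) * g x) x ∂μ := by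
        rw [ENNReal.tsum_mul_left,
          lintegral_tsum fun k => ((hg.const_mul _).indicator (hAm k)).aemeasurable]
    _ ≤ D * ∫⁻ x, G * ENNReal.ofReal (2 * c) ^ (q - 1) * g x ^ q ∂μ := by
        gcongr with x
        calc ∑' k : ℤ, (A k).indicator (fun x => ((2 : ℝ≥0∞) ^ k) ^ (q - 1) * g x) x
            = (∑' k : ℤ, if (2 : ℝ≥0∞) ^ k < ENNReal.ofReal (2 * c) * g x then
                ((2 : ℝ≥0∞) ^ k) ^ (q - 1) else 0) * g x := by
              rw [← ENNReal.tsum_mul_right]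
              refine tsum_congr fun k => ?_
              simp only [Set.indicator_apply, hA, Set.mem_ofPred_eq, ite_mul, zero_mul]
          _ ≤ G * (ENNReal.ofReal (2 * c) * g x) ^ (q - 1) * g x := by
              gcongr; exact tsum_dyadic_le_rpow hq0 _
          _ = G * ENNReal.ofReal (2 * c) ^ (q - 1) * (g x ^ (q - 1) * g x ^ (1 : ℝ)) := by
              rw [ENNReal.mul_rpow_of_nonneg _ _ hq0.le, ENNReal.rpow_one]; ring
          _ = _ := by
              rw [← ENNReal.rpow_add_of_nonneg _ _ hq0.le zero_le_one, sub_add_cancel]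
    _ = _ := by
        rw [lintegral_const_mul _ (hg.pow_const q)]; ring

omit [BorelSpace X] in
/-- Hölder bound for averages over balls in terms of the `L^q` norm. -/
theorem setLIntegral_ball_le_rpow {μ : Measure X} {c ν q : ℝ} (hc : 0 < c) (hq : 1 < q)
    (hU : ∀ (x : X) (r : ℝ), 0 < r → μ (ball x r) ≤ ENNReal.ofReal (c * r ^ ν))
    {g : X → ℝ≥0∞} (hg : Measurable g) (x : X) {r : ℝ} (hr : 0 < r) :
    (ENNReal.ofReal (r ^ ν))⁻¹ * ∫⁻ y in ball x r, g y ∂μ ≤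
      ENNReal.ofReal (c ^ (1 - 1 / q)) * ENNReal.ofReal (r ^ (-(ν / q))) * lpNormE μ q g := by
  have hpq := Real.HolderConjugate.conjExponent hq
  have hexp : 1 / q.conjExponent = 1 - 1 / q := by
    rw [one_div, one_div]; linarith [hpq.inv_add_inv_eq_one]
  have h0 : 0 ≤ 1 - 1 / q := by
    rw [← hexp]; exact one_div_nonneg.2 hpq.symm.nonneg
  have hH := ENNReal.lintegral_mul_le_Lp_mul_Lq (μ.restrict (ball x r)) hpq
    (f := g) (g := fun _ => 1) hg.aemeasurable aemeasurable_const
  simp only [Pi.mul_apply, mul_one, ENNReal.one_rpow, lintegral_const, one_mul,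
    Measure.restrict_apply_univ, hexp] at hH
  have h1 : (∫⁻ y in ball x r, g y ^ q ∂μ) ^ (1 / q) ≤ lpNormE μ q g :=
    ENNReal.rpow_le_rpow (setLIntegral_le_lintegral _ _) (by positivity)
  calc (ENNReal.ofReal (r ^ ν))⁻¹ * ∫⁻ y in ball x r, g y ∂μ
      ≤ (ENNReal.ofReal (r ^ ν))⁻¹ *
          (lpNormE μ q g * ENNReal.ofReal (c * r ^ ν) ^ (1 - 1 / q)) := by
        gcongr
        exact hH.trans (mul_le_mul' h1 (ENNReal.rpow_le_rpow (hU x r hr) h0))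
    _ = _ := by
        rw [← ENNReal.ofReal_inv_of_pos (by positivity),
          ENNReal.ofReal_rpow_of_nonneg (by positivity) h0, mul_left_comm,
          ← ENNReal.ofReal_mul (by positivity), ← ENNReal.ofReal_mul (by positivity), mul_comm]
        congr 2
        rw [Real.mul_rpow hc.le (by positivity), ← Real.rpow_mul hr.le, ← Real.rpow_neg hr.le,
          mul_left_comm, ← Real.rpow_add hr]
        congr 2; ring

/-- A Jensen-type bound that needs no measurability of `h`. -/
theorem lintegral_le_of_rpow_mean_le {α : Type*} [MeasurableSpace α] {μ : Measure α} {ρ : ℝ}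
    (hρ : 1 < ρ) (hμ0 : μ Set.univ ≠ 0) (hμ : μ Set.univ ≠ ∞) {h : α → ℝ≥0∞} {G : ℝ≥0∞}
    (hG : ((μ Set.univ)⁻¹ * ∫⁻ y, h y ^ ρ ∂μ) ^ (1 / ρ) ≤ G) :
    ∫⁻ y, h y ∂μ ≤ 2 * μ Set.univ * G := by
  have hρ0 : 0 < ρ - 1 := by linarith
  set m := μ Set.univ
  have h2m0 : 2 * m ≠ 0 := mul_ne_zero two_ne_zero hμ0
  have h2m : 2 * m ≠ ∞ := ENNReal.mul_ne_top (by norm_num) hμ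
  suffices H : (∫⁻ y, h y ∂μ) / (2 * m) ≤ G by
    rwa [ENNReal.div_le_iff_le_mul (Or.inl h2m0) (Or.inl h2m), mul_comm] at H
  refine le_of_forall_gt_imp_ge_of_dense fun l hl => ?_
  rcases eq_or_ne l ∞ with rfl | hlt
  · exact le_top
  have hl0 : l ≠ 0 := (lt_of_le_of_lt zero_le hl).ne'
  have hlp0 : l ^ (ρ - 1) ≠ 0 := by simp [ENNReal.rpow_eq_zero_iff, hl0, hlt]
  have hlpt : l ^ (ρ - 1) ≠ ∞ := ENNReal.rpow_ne_top_of_nonneg hρ0.le hlt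
  have hlρ : l ^ (ρ - 1) * l = l ^ ρ := by
    nth_rewrite 2 [← ENNReal.rpow_one l]
    rw [← ENNReal.rpow_add _ _ hl0 hlt, sub_add_cancel]
  have hint : ∫⁻ y, h y ^ ρ ∂μ ≤ m * l ^ ρ := by
    have h1 := hG.trans hl.le
    rw [one_div, ENNReal.rpow_inv_le_iff (by linarith), mul_comm, ← div_eq_mul_inv,
      ENNReal.div_le_iff_le_mul (Or.inl hμ0) (Or.inl hμ)] at h1
    rwa [mul_comm]
  have hpt : ∀ y, h y ≤ l + (l ^ (ρ - 1))⁻¹ * h y ^ ρ := by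
    intro y
    rcases le_or_gt (h y) l with hy | hy
    · exact hy.trans le_self_add
    · refine le_trans ?_ le_add_self
      rw [mul_comm, ← div_eq_mul_inv, ENNReal.le_div_iff_mul_le (Or.inl hlp0) (Or.inl hlpt)]
      calc h y * l ^ (ρ - 1) ≤ h y ^ (1 : ℝ) * h y ^ (ρ - 1) := by
            rw [ENNReal.rpow_one]; gcongr
        _ = h y ^ ρ := by
            rw [← ENNReal.rpow_add_of_nonneg _ _ zero_le_one hρ0.le]; congr 1; ring
  rw [ENNReal.div_le_iff_le_mul (Or.inl h2m0) (Or.inl h2m)]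
  calc ∫⁻ y, h y ∂μ ≤ ∫⁻ y, (l + (l ^ (ρ - 1))⁻¹ * h y ^ ρ) ∂μ := lintegral_mono hpt
    _ = l * m + (l ^ (ρ - 1))⁻¹ * ∫⁻ y, h y ^ ρ ∂μ := by
        rw [lintegral_add_left measurable_const, lintegral_const,
          lintegral_const_mul' _ _ (ENNReal.inv_ne_top.2 hlp0)]
    _ ≤ l * m + (l ^ (ρ - 1))⁻¹ * (m * (l ^ (ρ - 1) * l)) := by rw [hlρ]; gcongr
    _ = l * m + ((l ^ (ρ - 1))⁻¹ * l ^ (ρ - 1)) * (m * l) := by ring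
    _ = l * (2 * m) := by rw [ENNReal.inv_mul_cancel hlp0 hlpt]; ring

omit [BorelSpace X] in
theorem PoincareSobolev.setLIntegral_enorm_sub_le {μ : Measure X} {f : X → ℝ} {g : X → ℝ≥0∞}
    {ρ' CP σ : ℝ} (h : PoincareSobolev μ f g ρ' CP σ) (hρ' : 1 < ρ') {x : X} {r : ℝ} (hr : 0 < r)
    (h0 : μ (ball x r) ≠ 0) (ht : μ (ball x r) ≠ ∞) :
    ∫⁻ y in ball x r, ‖f y - ⨍ z in ball x r, f z ∂μ‖ₑ ∂μ ≤
      2 * μ (ball x r) * (ENNReal.ofReal (CP * r) *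
        ((μ (ball x (σ * r)))⁻¹ * ∫⁻ y in ball x (σ * r), g y ∂μ)) := by
  have key := lintegral_le_of_rpow_mean_le (μ := μ.restrict (ball x r)) hρ'
    (h := fun y => ‖f y - ⨍ z in ball x r, f z ∂μ‖ₑ) (by simpa using h0) (by simpa using ht)
    (G := ENNReal.ofReal (CP * r) *
        ((μ (ball x (σ * r)))⁻¹ * ∫⁻ y in ball x (σ * r), g y ∂μ)) (by
      refine le_trans (le_of_eq ?_) (h x r hr)
      simp only [Measure.restrict_apply_univ, Real.enorm_eq_ofReal_abs]
      congr 3 with y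
      exact ENNReal.ofReal_rpow_of_nonneg (abs_nonneg _) (by linarith))
  simpa only [Measure.restrict_apply_univ] using key

omit [BorelSpace X] in
/-- On a set inside an annulus where the kernel has mean zero, a constant may be subtracted. -/
theorem enorm_setIntegral_kernel_mul_le {μ : Measure X} {ν CK : ℝ} {K : X → X → ℝ} {f : X → ℝ}
    (hCK : 0 < CK) (hν : 0 < ν) (hsize : SizeCond K CK ν) {x : X} {s : ℝ} (hs : 0 < s)
    {E : Set X} (hEm : MeasurableSet E) (hE : ∀ y ∈ E, s ≤ dist x y)
    (hEb : E ⊆ ball x (2 * s)) (hK0 : ∫ y in E, K x y ∂μ = 0)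
    (hKint : IntegrableOn (K x) E μ) (hint : IntegrableOn (fun y => K x y * f y) E μ) (a : ℝ) :
    ‖∫ y in E, K x y * f y ∂μ‖ₑ ≤
      ENNReal.ofReal (CK / s ^ ν) * ∫⁻ y in ball x (2 * s), ‖f y - a‖ₑ ∂μ := by
  have heq : ∫ y in E, K x y * f y ∂μ = ∫ y in E, K x y * (f y - a) ∂μ := by
    simp_rw [mul_sub]
    rw [integral_sub hint (hKint.mul_const a), integral_mul_const, hK0, zero_mul, sub_zero]
  rw [heq]
  calc ‖∫ y in E, K x y * (f y - a) ∂μ‖ₑ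
      ≤ ∫⁻ y in E, ‖K x y * (f y - a)‖ₑ ∂μ := enorm_integral_le_lintegral_enorm _
    _ ≤ ∫⁻ y in E, ENNReal.ofReal (CK / s ^ ν) * ‖f y - a‖ₑ ∂μ := by
        refine setLIntegral_mono' hEm fun y hy => ?_
        rw [enorm_mul]
        gcongr
        rw [Real.enorm_eq_ofReal_abs]
        refine ENNReal.ofReal_le_ofReal ?_
        have hd : 0 < dist x y := hs.trans_le (hE y hy)
        refine (hsize x y (dist_pos.1 hd)).trans ?_
        have := Real.rpow_le_rpow hs.le (hE y hy) hν.le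
        gcongr
    _ ≤ ∫⁻ y in ball x (2 * s), ENNReal.ofReal (CK / s ^ ν) * ‖f y - a‖ₑ ∂μ :=
        lintegral_mono_set hEb
    _ = _ := lintegral_const_mul' _ _ ENNReal.ofReal_ne_top

theorem sum_dyadic_le_two_mul {a R : ℝ} (ha : 0 < a) (hR : 0 < R) (n : ℕ) :
    ∑ k ∈ Finset.range n, (if 2 ^ k * a ≤ R then 2 ^ k * a else 0) ≤ 2 * R := by
  suffices H : ∑ k ∈ Finset.range n, (if 2 ^ k * a ≤ R then 2 ^ k * a else 0) ≤ 2 * R ∧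
      ∑ k ∈ Finset.range n, (if 2 ^ k * a ≤ R then 2 ^ k * a else 0) ≤ 2 ^ n * a from H.1
  induction n with
  | zero => simp [ha.le, hR.le]
  | succ n ih =>
    have h0 : 0 < 2 ^ n * a := by positivity
    rw [Finset.sum_range_succ, pow_succ]
    split_ifs <;> constructor <;> linarith [ih.1, ih.2]

theorem sum_dyadic_rpow_neg_le {β R : ℝ} (hβ : 0 < β) (hR : 0 < R) (n : ℕ) {a : ℝ}
    (ha : 0 < a) :
    ∑ k ∈ Finset.range n, (if 2 ^ k * a ≤ R then 0 else (2 ^ k * a) ^ (-β)) ≤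
      (1 - 2 ^ (-β))⁻¹ * R ^ (-β) := by
  have h2 : (2 : ℝ) ^ (-β) < 1 := Real.rpow_lt_one_of_one_lt_of_neg (by norm_num) (by linarith)
  have hpos : 0 < 1 - (2 : ℝ) ^ (-β) := by linarith
  suffices H : ∑ k ∈ Finset.range n, (if 2 ^ k * a ≤ R then 0 else (2 ^ k * a) ^ (-β)) ≤
      (1 - 2 ^ (-β))⁻¹ * (max a R) ^ (-β) by
    refine H.trans ?_
    have := Real.rpow_le_rpow_of_nonpos hR (le_max_right a R) (neg_nonpos.2 hβ.le)
    gcongr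
  induction n generalizing a with
  | zero => simp only [Finset.range_zero, Finset.sum_empty]; positivity
  | succ n ih =>
    rw [Finset.sum_range_succ']
    have h1 := ih (a := 2 * a) (by linarith)
    have hshift : ∀ k : ℕ, (2 : ℝ) ^ (k + 1) * a = 2 ^ k * (2 * a) := fun k => by ring
    simp only [hshift, pow_zero, one_mul]
    split_ifs with h
    · rw [max_eq_right h, add_zero]
      refine h1.trans ?_
      have := Real.rpow_le_rpow_of_nonpos hR (le_max_right (2 * a) R) (neg_nonpos.2 hβ.le)
      gcongr
    · rw [not_le] at h
      rw [max_eq_left (by linarith), Real.mul_rpow (by norm_num) ha.le] at h1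
      rw [max_eq_left h.le]
      refine (add_le_add_left h1 _).trans (le_of_eq ?_)
      field_simp
      ring

theorem sum_dyadic_le {A : ℝ → ℝ≥0∞} {M H : ℝ≥0∞} {β R a : ℝ} (hβ : 0 < β) (hR : 0 < R)
    (ha : 0 < a) (hM : ∀ r, 0 < r → A r ≤ M)
    (hH : ∀ r, 0 < r → ENNReal.ofReal r * A r ≤ H * ENNReal.ofReal (r ^ (-β))) (n : ℕ) :
    ∑ k ∈ Finset.range n, ENNReal.ofReal (2 ^ k * a) * A (2 ^ k * a) ≤
      ENNReal.ofReal (2 * R) * M + H * ENNReal.ofReal ((1 - 2 ^ (-β))⁻¹ * R ^ (-β)) := by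
  calc ∑ k ∈ Finset.range n, ENNReal.ofReal (2 ^ k * a) * A (2 ^ k * a)
      ≤ ∑ k ∈ Finset.range n, (ENNReal.ofReal (if 2 ^ k * a ≤ R then 2 ^ k * a else 0) * M +
          H * ENNReal.ofReal (if 2 ^ k * a ≤ R then 0 else (2 ^ k * a) ^ (-β))) := by
        refine Finset.sum_le_sum fun k _ => ?_
        have hk : 0 < 2 ^ k * a := by positivity
        split_ifs
        · refine le_add_right ?_
          gcongr
          exact hM _ hk
        · exact le_add_left (hH _ hk)
    _ = ENNReal.ofReal (∑ k ∈ Finset.range n, (if 2 ^ k * a ≤ R then 2 ^ k * a else 0)) * M +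
          H * ENNReal.ofReal
            (∑ k ∈ Finset.range n, (if 2 ^ k * a ≤ R then 0 else (2 ^ k * a) ^ (-β))) := by
        rw [Finset.sum_add_distrib, ← Finset.sum_mul, ← Finset.mul_sum,
          ENNReal.ofReal_sum_of_nonneg fun k _ => by split_ifs <;> positivity,
          ENNReal.ofReal_sum_of_nonneg fun k _ => by split_ifs <;> positivity]
    _ ≤ _ := by
        gcongr
        · exact sum_dyadic_le_two_mul ha hR n
        · exact sum_dyadic_rpow_neg_le hβ hR n ha

/-- If a quantity is controlled by `R M + R ^ (-β) N` at every scale `R`, it is controlled by the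
geometric mean obtained by optimising in `R`. -/
theorem le_rpow_mul_rpow_of_forall_scale {T M N C : ℝ≥0∞} {β : ℝ} (hβ : 0 < β) (hC : C ≠ ∞)
    (hN : N ≠ ∞) (hNM : N = 0 → M = 0)
    (h : ∀ R : ℝ, 0 < R → T ≤ C * (ENNReal.ofReal R * M + N * ENNReal.ofReal (R ^ (-β)))) :
    T ≤ 2 * C * (M ^ (β / (1 + β)) * N ^ (1 / (1 + β))) := by
  have hβ1 : 0 < 1 + β := by linarith
  rcases eq_or_ne M 0 with rfl | hM0
  · have hlim : Filter.Tendsto (fun R : ℝ => C * (N * ENNReal.ofReal (R ^ (-β)))) Filter.atTop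
        (nhds (C * (N * ENNReal.ofReal 0))) :=
      ENNReal.Tendsto.const_mul (ENNReal.Tendsto.const_mul
        (ENNReal.tendsto_ofReal (tendsto_rpow_neg_atTop hβ)) (Or.inr hN)) (Or.inr hC)
    have hT : T ≤ C * (N * ENNReal.ofReal 0) := by
      refine ge_of_tendsto hlim ?_
      filter_upwards [Filter.eventually_gt_atTop 0] with R hR
      simpa using h R hR
    refine hT.trans ?_
    simp
  have hN0 : N ≠ 0 := fun h0 => hM0 (hNM h0)
  rcases eq_or_ne C 0 with rfl | hC0
  · simpa using h 1 one_pos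
  rcases eq_or_ne M ∞ with rfl | hMt
  · rw [ENNReal.top_rpow_of_pos (by positivity), ENNReal.top_mul, ENNReal.mul_top]
    · exact le_top
    · exact mul_ne_zero two_ne_zero hC0
    · simp [ENNReal.rpow_eq_zero_iff, hN0, hN]
  lift M to NNReal using hMt
  lift N to NNReal using hN
  have hm : 0 < (M : ℝ) := NNReal.coe_pos.2 (pos_iff_ne_zero.2 (by simpa using hM0))
  have hn : 0 < (N : ℝ) := NNReal.coe_pos.2 (pos_iff_ne_zero.2 (by simpa using hN0))
  have hexp : β / (1 + β) = 1 - 1 / (1 + β) := by field_simp; ring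
  have e1 : ((N : ℝ) / M) ^ (1 / (1 + β)) * M =
      (M : ℝ) ^ (β / (1 + β)) * (N : ℝ) ^ (1 / (1 + β)) := by
    rw [Real.div_rpow hn.le hm.le, hexp, Real.rpow_sub hm, Real.rpow_one]
    ring
  have e2 : (N : ℝ) * (((N : ℝ) / M) ^ (1 / (1 + β))) ^ (-β) =
      (M : ℝ) ^ (β / (1 + β)) * (N : ℝ) ^ (1 / (1 + β)) := by
    rw [← Real.rpow_mul (by positivity), Real.div_rpow hn.le hm.le,
      show 1 / (1 + β) * -β = -(β / (1 + β)) by ring, Real.rpow_neg hn.le, Real.rpow_neg hm.le,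
      show 1 / (1 + β) = 1 - β / (1 + β) by rw [hexp]; ring, Real.rpow_sub hn, Real.rpow_one]
    field_simp
  refine (h (((N : ℝ) / M) ^ (1 / (1 + β))) (by positivity)).trans (le_of_eq ?_)
  rw [← ENNReal.ofReal_coe_nnreal (p := M), ← ENNReal.ofReal_coe_nnreal (p := N),
    ← ENNReal.ofReal_mul (by positivity), ← ENNReal.ofReal_mul hn.le, e1, e2,
    ENNReal.ofReal_rpow_of_pos hm, ENNReal.ofReal_rpow_of_pos hn,
    ← ENNReal.ofReal_mul (by positivity)]
  ring

omit [BorelSpace X] in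
theorem SizeCond.integrableOn_s11 {μ : Measure X} {ν CK : ℝ} {K : X → X → ℝ}
    (hsize : SizeCond K CK ν) (hCK : 0 < CK) (hν : 0 < ν)
    (hK : Measurable (Function.uncurry K)) {x : X} {s : ℝ} (hs : 0 < s) {E : Set X}
    (hEm : MeasurableSet E) (hE : ∀ y ∈ E, s ≤ dist x y) (hfin : μ E ≠ ∞) :
    IntegrableOn (K x) E μ := by
  refine Measure.integrableOn_of_bounded (M := CK / s ^ ν) hfin
    (hK.comp measurable_prodMk_left).aestronglyMeasurable ?_
  filter_upwards [ae_restrict_mem hEm] with y hy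
  have hd : 0 < dist x y := hs.trans_le (hE y hy)
  refine (hsize x y (dist_pos.1 hd)).trans ?_
  have := Real.rpow_le_rpow hs.le (hE y hy) hν.le
  gcongr

/-- A truncated integral is dominated by any uniform bound for sums over dyadic annuli. -/
theorem enorm_truncT_le_of_annuli {μ : Measure X} {K : X → X → ℝ} {f : X → ℝ} {ε : ℝ}
    (hε : 0 < ε) {x : X} {b : ℕ → ℝ≥0∞} {B : ℝ≥0∞}
    (hb : IntegrableOn (fun y => K x y * f y) {y | ε < dist x y} μ → ∀ n : ℕ,
      ‖∫ y in {y | ε < dist x y ∧ dist x y < 2 ^ (n + 1) * ε} \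
        {y | ε < dist x y ∧ dist x y < 2 ^ n * ε}, K x y * f y ∂μ‖ₑ ≤ b n)
    (hB : ∀ n, ∑ k ∈ Finset.range n, b k ≤ B) :
    ‖truncT μ K f ε x‖ₑ ≤ B := by
  unfold truncT
  by_cases hint : IntegrableOn (fun y => K x y * f y) {y | ε < dist x y} μ
  swap
  · rw [integral_undef hint]; simp
  replace hb := hb hint
  set S : ℕ → Set X := fun n => {y | ε < dist x y ∧ dist x y < 2 ^ n * ε} with hS
  have hSm : ∀ n, MeasurableSet (S n) := fun n =>
    ((isOpen_lt continuous_const (continuous_const.dist continuous_id)).inter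
      (isOpen_lt (continuous_const.dist continuous_id) continuous_const)).measurableSet
  have hmono : Monotone S := by
    intro m n hmn y hy
    refine ⟨hy.1, hy.2.trans_le ?_⟩
    gcongr
    norm_num
  have hunion : ⋃ n, S n = {y | ε < dist x y} := by
    refine Set.Subset.antisymm (Set.iUnion_subset fun n y hy => hy.1) fun y hy => ?_
    obtain ⟨n, hn⟩ := pow_unbounded_of_one_lt (dist x y / ε) (one_lt_two (α := ℝ))
    exact Set.mem_iUnion.2 ⟨n, hy, (div_lt_iff₀ hε).1 hn⟩
  have hle : ∀ n, ‖∫ y in S n, K x y * f y ∂μ‖ₑ ≤ ∑ k ∈ Finset.range n, b k := by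
    intro n
    induction n with
    | zero =>
      have : S 0 = ∅ := by
        refine Set.eq_empty_of_forall_notMem fun y hy => ?_
        have h2 := hy.2
        rw [pow_zero, one_mul] at h2
        exact lt_asymm hy.1 h2
      simp [this]
    | succ n ih =>
      have hd := setIntegral_sdiff (μ := μ) (f := fun y => K x y * f y) (hSm n)
        (hint.mono_set (fun y hy => hy.1 : S (n + 1) ⊆ _)) (hmono n.le_succ)
      rw [Finset.sum_range_succ, ← sub_add_cancel (∫ y in S (n + 1), K x y * f y ∂μ)
        (∫ y in S n, K x y * f y ∂μ), ← hd, add_comm]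
      exact (enorm_add_le _ _).trans (add_le_add ih (hb n))
  have hlim := tendsto_setIntegral_of_monotone (f := fun y => K x y * f y) hSm hmono
    (by rw [hunion]; exact hint)
  rw [hunion] at hlim
  exact le_of_tendsto' hlim.enorm fun n => (hle n).trans (hB n)

theorem enorm_truncT_le_sum {μ : Measure X} {c₁ c₂ ν CK CP σ ρ' : ℝ} {K : X → X → ℝ}
    {f : X → ℝ} {g : X → ℝ≥0∞}
    (hc₁ : 0 < c₁) (hc₂ : 0 < c₂) (hν : 0 < ν) (hA : IsAhlfors μ c₁ c₂ ν)
    (hK : Measurable (Function.uncurry K)) (hCK : 0 < CK)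
    (hsize : SizeCond K CK ν) (hnull : NullCond μ K)
    (hρ' : 1 < ρ') (hCP : 0 < CP) (hσ : 1 ≤ σ) (hPS : PoincareSobolev μ f g ρ' CP σ)
    {ε : ℝ} (hε : 0 < ε) (x : X) {B : ℝ≥0∞}
    (hB : ∀ n, ∑ k ∈ Finset.range n, ENNReal.ofReal (2 ^ k * (2 * σ * ε)) *
      ((ENNReal.ofReal ((2 ^ k * (2 * σ * ε)) ^ ν))⁻¹ *
        ∫⁻ y in ball x (2 ^ k * (2 * σ * ε)), g y ∂μ) ≤ B) :
    ‖truncT μ K f ε x‖ₑ ≤ ENNReal.ofReal (2 * CK * c₂ * 2 ^ ν * CP / (c₁ * σ)) * B := by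
  have hσ0 : 0 < σ := by linarith
  have hball0 : ∀ r : ℝ, 0 < r → μ (ball x r) ≠ 0 := fun r hr h0 => by
    have := (hA x r hr).1
    rw [h0, nonpos_iff_eq_zero, ENNReal.ofReal_eq_zero] at this
    exact absurd this (not_le.2 (by positivity))
  have hballt : ∀ r : ℝ, 0 < r → μ (ball x r) ≠ ∞ := fun r hr =>
    ne_top_of_le_ne_top ENNReal.ofReal_ne_top (hA x r hr).2
  refine enorm_truncT_le_of_annuli hε (b := fun k =>
    ENNReal.ofReal (2 * CK * c₂ * 2 ^ ν * CP / (c₁ * σ)) *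
    (ENNReal.ofReal (2 ^ k * (2 * σ * ε)) *
      ((ENNReal.ofReal ((2 ^ k * (2 * σ * ε)) ^ ν))⁻¹ *
        ∫⁻ y in ball x (2 ^ k * (2 * σ * ε)), g y ∂μ))) (fun hint n => ?_)
    (fun n => by rw [← Finset.mul_sum]; gcongr; exact hB n)
  set S : ℕ → Set X := fun n => {y | ε < dist x y ∧ dist x y < 2 ^ n * ε} with hS
  have hSm : ∀ n, MeasurableSet (S n) := fun n =>
    ((isOpen_lt continuous_const (continuous_const.dist continuous_id)).inter
      (isOpen_lt (continuous_const.dist continuous_id) continuous_const)).measurableSet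
  have hmono : S n ⊆ S (n + 1) := fun y hy => ⟨hy.1, hy.2.trans_le (by gcongr <;> norm_num)⟩
  have hSfin : ∀ n, μ (S n) ≠ ∞ := fun n =>
    ne_top_of_le_ne_top (hballt (2 ^ n * ε) (by positivity))
      (measure_mono fun y hy => by rw [mem_ball, dist_comm]; exact hy.2)
  have hKS : ∀ n, IntegrableOn (K x) (S n) μ := fun n =>
    hsize.integrableOn_s11 hCK hν hK hε (hSm n) (fun y hy => hy.1.le) (hSfin n)
  have hK0 : ∀ n, ∫ y in S n, K x y ∂μ = 0 := by
    intro n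
    rcases lt_or_ge ε (2 ^ n * ε) with h | h
    · exact hnull x ε _ hε h
    · have : S n = ∅ := Set.eq_empty_of_forall_notMem fun y hy =>
        absurd (hy.1.trans hy.2) (not_lt.2 h)
      simp [this]
  set s : ℝ := 2 ^ n * ε with hs
  have hs0 : 0 < s := by positivity
  have hr : 2 ^ n * (2 * σ * ε) = σ * (2 * s) := by rw [hs]; ring
  rw [hr]
  have hkey := enorm_setIntegral_kernel_mul_le (f := f) hCK hν hsize hs0
    ((hSm (n + 1)).diff (hSm n)) (x := x)
    (fun y hy => by
      by_contra hcon
      exact hy.2 ⟨hy.1.1, not_le.1 hcon⟩)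
    (fun y hy => by
      rw [mem_ball, dist_comm]
      refine hy.1.2.trans_eq ?_
      rw [hs, pow_succ]; ring)
    (by rw [setIntegral_sdiff (hSm n) (hKS _) hmono, hK0, hK0, sub_zero])
    ((hKS _).mono_set Set.sdiff_subset)
    (hint.mono_set fun y hy => hy.1.1) (⨍ z in ball x (2 * s), f z ∂μ)
  have hPS' := hPS.setLIntegral_enorm_sub_le hρ' (x := x) (r := 2 * s) (by positivity)
    (hball0 _ (by positivity)) (hballt _ (by positivity))
  have hr0 : 0 < σ * (2 * s) := by positivity
  set I := ∫⁻ y in ball x (σ * (2 * s)), g y ∂μ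
  calc _ ≤ ENNReal.ofReal (CK / s ^ ν) * ∫⁻ y in ball x (2 * s),
            ‖f y - ⨍ z in ball x (2 * s), f z ∂μ‖ₑ ∂μ := hkey
    _ ≤ ENNReal.ofReal (CK / s ^ ν) * (2 * μ (ball x (2 * s)) * (ENNReal.ofReal (CP * (2 * s)) *
        ((μ (ball x (σ * (2 * s))))⁻¹ * I))) := by gcongr
    _ ≤ ENNReal.ofReal (CK / s ^ ν) * (ENNReal.ofReal 2 * ENNReal.ofReal (c₂ * (2 * s) ^ ν) *
        (ENNReal.ofReal (CP * (2 * s)) *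
          ((ENNReal.ofReal (c₁ * (σ * (2 * s)) ^ ν))⁻¹ * I))) := by
        rw [ENNReal.ofReal_ofNat]
        gcongr
        · exact (hA x _ (by positivity)).2
        · exact (hA x _ hr0).1
    _ = _ := by
        rw [← ENNReal.ofReal_inv_of_pos (by positivity), ← ENNReal.ofReal_inv_of_pos (by positivity)]
        simp only [← mul_assoc]
        rw [← ENNReal.ofReal_mul (by positivity), ← ENNReal.ofReal_mul (by positivity),
          ← ENNReal.ofReal_mul (by positivity), ← ENNReal.ofReal_mul (by positivity),
          ← ENNReal.ofReal_mul (by positivity), ← ENNReal.ofReal_mul (by positivity)]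
        congr 2
        rw [Real.mul_rpow (x := 2) (by norm_num) hs0.le]
        field_simp

theorem maxT_le_growthMax_rpow {μ : Measure X} {c₁ c₂ ν CK CP σ ρ' : ℝ} {K : X → X → ℝ}
    {f : X → ℝ} {g : X → ℝ≥0∞}
    (hc₁ : 0 < c₁) (hc₂ : 0 < c₂) (hν : 0 < ν) (hA : IsAhlfors μ c₁ c₂ ν)
    (hK : Measurable (Function.uncurry K)) (hCK : 0 < CK)
    (hsize : SizeCond K CK ν) (hnull : NullCond μ K)
    (hρ' : 1 < ρ') (hCP : 0 < CP) (hσ : 1 ≤ σ) (hPS : PoincareSobolev μ f g ρ' CP σ)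
    (hg : Measurable g) {q : ℝ} (hq : 1 < q) (hqν : q < ν) (hN : lpNormE μ q g ≠ ∞) :
    ∃ C : ℝ≥0∞, C ≠ ∞ ∧ ∀ x, maxT μ K f x ≤
      C * (growthMax μ ν g x ^ (1 - q / ν) * lpNormE μ q g ^ (q / ν)) := by
  have hq0 : 0 < q := by linarith
  set β : ℝ := ν / q - 1 with hβdef
  have hβ : 0 < β := by rw [hβdef, sub_pos, one_lt_div hq0]; exact hqν
  set N := lpNormE μ q g
  set H : ℝ≥0∞ := ENNReal.ofReal (c₂ ^ (1 - 1 / q)) with hH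
  have hHt : H ≠ ∞ := ENNReal.ofReal_ne_top
  set G : ℝ := (1 - (2 : ℝ) ^ (-β))⁻¹ with hG
  have hG0 : 0 ≤ G := by
    have : (2 : ℝ) ^ (-β) < 1 := Real.rpow_lt_one_of_one_lt_of_neg (by norm_num) (by linarith)
    rw [hG, inv_nonneg]; linarith
  set C₀ : ℝ≥0∞ := ENNReal.ofReal (2 * CK * c₂ * 2 ^ ν * CP / (c₁ * σ)) with hC₀
  set C₁ : ℝ≥0∞ := C₀ * (2 + H * ENNReal.ofReal G) with hC₁
  have hC₁t : C₁ ≠ ∞ := ENNReal.mul_ne_top ENNReal.ofReal_ne_top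
    (ENNReal.add_ne_top.2 ⟨by norm_num, ENNReal.mul_ne_top hHt ENNReal.ofReal_ne_top⟩)
  have hU := fun x r (hr : (0 : ℝ) < r) => (hA x r hr).2
  have hHölder := fun x r (hr : (0 : ℝ) < r) => setLIntegral_ball_le_rpow hc₂ hq hU hg x hr
  refine ⟨2 * C₁, ENNReal.mul_ne_top (by norm_num) hC₁t, fun x => ?_⟩
  have hscale : ∀ R : ℝ, 0 < R → maxT μ K f x ≤
      C₁ * (ENNReal.ofReal R * growthMax μ ν g x + N * ENNReal.ofReal (R ^ (-β))) := by
    intro R hR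
    refine iSup₂_le fun ε hε => ?_
    rw [← Real.enorm_eq_ofReal_abs]
    have hσ0 : 0 < σ := by linarith
    refine (enorm_truncT_le_sum hc₁ hc₂ hν hA hK hCK hsize hnull hρ' hCP hσ hPS hε x
      (sum_dyadic_le (A := fun r => (ENNReal.ofReal (r ^ ν))⁻¹ * ∫⁻ y in ball x r, g y ∂μ)
        hβ hR (by positivity) (fun r hr => le_growthMax μ ν g x hr)
        (H := H * N) (fun r hr => ?_))).trans ?_
    · calc _ ≤ ENNReal.ofReal r * (H * ENNReal.ofReal (r ^ (-(ν / q))) * N) := by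
            exact mul_le_mul' le_rfl (hHölder x r hr)
        _ = H * N * (ENNReal.ofReal r * ENNReal.ofReal (r ^ (-(ν / q)))) := by ring
        _ = _ := by
            rw [← ENNReal.ofReal_mul hr.le]
            nth_rewrite 1 [← Real.rpow_one r]
            rw [← Real.rpow_add hr]
            congr 3; rw [hβdef]; ring
    · rw [ENNReal.ofReal_mul two_pos.le, ENNReal.ofReal_mul hG0, ENNReal.ofReal_ofNat, hC₁,
        mul_assoc C₀]
      gcongr
      calc 2 * ENNReal.ofReal R * growthMax μ ν g x +
            H * N * (ENNReal.ofReal G * ENNReal.ofReal (R ^ (-β)))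
          = 2 * (ENNReal.ofReal R * growthMax μ ν g x) +
            H * ENNReal.ofReal G * (N * ENNReal.ofReal (R ^ (-β))) := by ring
        _ ≤ (2 + H * ENNReal.ofReal G) * (ENNReal.ofReal R * growthMax μ ν g x) +
            (2 + H * ENNReal.ofReal G) * (N * ENNReal.ofReal (R ^ (-β))) := by
            gcongr
            · exact le_self_add
            · exact le_add_self
        _ = _ := by ring
  have hNM : N = 0 → growthMax μ ν g x = 0 := by
    intro h0
    refine le_antisymm (iSup₂_le fun r hr => ?_) zero_le
    refine (hHölder x r hr).trans_eq ?_
    rw [show lpNormE μ q g = 0 from h0, mul_zero]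
  have hfin := le_rpow_mul_rpow_of_forall_scale hβ hC₁t hN hNM hscale
  have e : 1 + β = ν / q := by rw [hβdef]; ring
  rwa [e, hβdef, sub_div, div_self (by positivity), one_div_div] at hfin

/-- Sobolev-like inequality: with `r = qν/(ν-q)`,
`‖T^*_K f‖_{L^r} ≤ C ‖g‖_{L^q}`. -/
theorem sobolev_like_inequality
    (μ : Measure X) (c₁ c₂ ν CK CP σ ρ' : ℝ) (K : X → X → ℝ) (f : X → ℝ) (g : X → ℝ≥0∞)
    (hc₁ : 0 < c₁) (hc₁₂ : c₁ ≤ c₂) (hν : 0 < ν) (hA : IsAhlfors μ c₁ c₂ ν)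
    (hbal : (2 : ℝ) ^ (1 - ν) * (c₂ / c₁) < 1)
    (hK : Measurable (Function.uncurry K)) (hCK : 0 < CK)
    (hsize : SizeCond K CK ν) (hnull : NullCond μ K)
    (hf : LocallyIntegrable f μ) (hg : LocIntE μ g)
    (hρ'1 : 1 < ρ') (hρ'ν : ρ' < ν) (hCP : 0 < CP) (hσ : 1 ≤ σ)
    (hPS : PoincareSobolev μ f g ρ' CP σ)
    (q : ℝ) (hq : 1 < q) (hqν : q < ν)
    (hgL : ∫⁻ x, g x ^ q ∂μ < ∞) :
    ∃ C : ℝ, 0 < C ∧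
      lpNormE μ (q * ν / (ν - q)) (maxT μ K f) ≤ ENNReal.ofReal C * lpNormE μ q g := by
  have hq0 : 0 < q := by linarith
  have hc₂ : 0 < c₂ := hc₁.trans_le hc₁₂
  have hνq : 0 < ν - q := by linarith
  set r : ℝ := q * ν / (ν - q) with hr
  have hr0 : 0 < r := by positivity
  set N := lpNormE μ q g with hNdef
  have hN : N ≠ ∞ := ENNReal.rpow_ne_top_of_nonneg (by positivity) hgL.ne
  have hNq : ∫⁻ x, g x ^ q ∂μ = N ^ q := by
    rw [hNdef, lpNormE, one_div, ENNReal.rpow_inv_rpow hq0.ne']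
  obtain ⟨C₁, hC₁, hpt⟩ := maxT_le_growthMax_rpow hc₁ hc₂ hν hA hK hCK hsize hnull hρ'1 hCP hσ
    hPS hg.1 hq hqν hN
  obtain ⟨C₂, hC₂, hmax⟩ := lintegral_growthMax_rpow_le hc₂ hν hq
    (fun x s (hs : (0 : ℝ) < s) => (hA x s hs).2)
  have hexp : (1 - q / ν) * r = q := by rw [hr]; field_simp
  have hexp' : q / ν + q * (1 / r) = 1 := by rw [hr]; field_simp; ring
  have hqν0 : 0 ≤ q / ν := by positivity
  set C : ℝ≥0∞ := C₁ * C₂ ^ (1 / r) with hCdef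
  have hC : C ≠ ∞ := ENNReal.mul_ne_top hC₁
    (ENNReal.rpow_ne_top_of_nonneg (by positivity) hC₂)
  refine ⟨C.toReal + 1, by positivity, ?_⟩
  have hmain : lpNormE μ r (maxT μ K f) ≤ C * N := by
    calc lpNormE μ r (maxT μ K f)
        ≤ (∫⁻ x, (C₁ * N ^ (q / ν)) ^ r * growthMax μ ν g x ^ q ∂μ) ^ (1 / r) := by
          refine ENNReal.rpow_le_rpow (lintegral_mono fun x => ?_) (by positivity)
          refine (ENNReal.rpow_le_rpow (hpt x) hr0.le).trans_eq ?_
          rw [mul_left_comm, mul_comm, ENNReal.mul_rpow_of_nonneg _ _ hr0.le, ← ENNReal.rpow_mul,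
            hexp]
      _ = C₁ * N ^ (q / ν) * (∫⁻ x, growthMax μ ν g x ^ q ∂μ) ^ (1 / r) := by
          rw [lintegral_const_mul' _ _ (ENNReal.rpow_ne_top_of_nonneg hr0.le
            (ENNReal.mul_ne_top hC₁ (ENNReal.rpow_ne_top_of_nonneg hqν0 hN))),
            ENNReal.mul_rpow_of_nonneg _ _ (by positivity), one_div,
            ENNReal.rpow_rpow_inv hr0.ne']
      _ ≤ C₁ * N ^ (q / ν) * (C₂ * N ^ q) ^ (1 / r) := by
          rw [← hNq]
          gcongr
          exact hmax g hg.1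
      _ = C * (N ^ (q / ν) * N ^ (q * (1 / r))) := by
          rw [ENNReal.mul_rpow_of_nonneg _ _ (by positivity), ← ENNReal.rpow_mul, hCdef]
          ring
      _ = C * N := by
          rw [← ENNReal.rpow_add_of_nonneg _ _ hqν0 (by positivity), hexp', ENNReal.rpow_one]
  refine hmain.trans ?_
  gcongr
  rw [← ENNReal.ofReal_toReal hC]
  exact ENNReal.ofReal_le_ofReal (by simp)
end
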